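/- ∫_0^∞ x^7/(cos x − cosh x)^3 dx = −105Γ^8/(2^11 π^2) − 21Γ^16/(2^16 π^6) + 7Γ^16/(2^14 π^5) − 9Γ^16/(2^17 π^4) − 5Γ^24/(2^23 π^10), where Γ = Γ(1/4). -/

import Mathlib

open Real

namespace HyperbolicSum

open Filter
open scoped Topology Interval

/-- The hyperbolic cosecant, with value `0` at `0`. -/
noncomputable def csch (x : ℝ) : ℝ := (Real.sinh x)⁻¹

/-- The hyperbolic cotangent, with value `0` at `0`. -/
noncomputable def coth (x : ℝ) : ℝ := Real.cosh x / Real.sinh x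

/-- Boundedness away from the origin. -/
def BddAway (g : ℝ → ℝ) : Prop := ∀ δ > 0, ∃ C, ∀ x, δ ≤ |x| → |g x| ≤ C

/-- Decay at least as fast as `exp (-|x|)`, uniformly away from the origin. -/
def Decays (g : ℝ → ℝ) : Prop := ∀ δ > 0, ∃ C, ∀ x, δ ≤ |x| → |g x| ≤ C * rexp (-|x|)

lemma csch_zero : csch 0 = 0 := by simp [csch]

lemma coth_zero : coth 0 = 0 := by simp [coth]

lemma csch_neg (x : ℝ) : csch (-x) = -csch x := by simp [csch, inv_neg]

lemma coth_neg (x : ℝ) : coth (-x) = -coth x := by simp [coth, div_neg]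

lemma coth_sq {x : ℝ} (hx : x ≠ 0) : coth x ^ 2 = 1 + csch x ^ 2 := by
  have h : Real.sinh x ≠ 0 := by simpa using hx
  have := Real.cosh_sq x
  unfold coth csch
  field_simp
  linarith

lemma hasDerivAt_csch {x : ℝ} (hx : x ≠ 0) : HasDerivAt csch (-(csch x * coth x)) x := by
  have h : Real.sinh x ≠ 0 := by simpa using hx
  refine ((Real.hasDerivAt_sinh x).inv h).congr_deriv ?_
  unfold coth csch
  field_simp

lemma hasDerivAt_coth {x : ℝ} (hx : x ≠ 0) : HasDerivAt coth (-(csch x ^ 2)) x := by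
  have h : Real.sinh x ≠ 0 := by simpa using hx
  refine ((Real.hasDerivAt_cosh x).div (Real.hasDerivAt_sinh x) h).congr_deriv ?_
  have := Real.cosh_sq x
  unfold csch
  field_simp
  linarith

lemma le_sinh {δ x : ℝ} (hx : δ ≤ x) :
    (1 - rexp (-2 * δ)) / 2 * rexp x ≤ Real.sinh x := by
  rw [Real.sinh_eq]
  have h1 : rexp (-x) = rexp (-2 * x) * rexp x := by rw [← Real.exp_add]; ring_nf
  have h2 : rexp (-2 * x) ≤ rexp (-2 * δ) := Real.exp_le_exp.2 (by linarith)
  nlinarith [Real.exp_pos x]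

lemma decays_csch : Decays csch := by
  intro δ hδ
  have hp : 0 < (1 - rexp (-2 * δ)) / 2 := by
    have : rexp (-2 * δ) < 1 := Real.exp_lt_one_iff.2 (by linarith)
    linarith
  refine ⟨((1 - rexp (-2 * δ)) / 2)⁻¹, fun x hx => ?_⟩
  rw [csch, abs_inv, Real.abs_sinh, Real.exp_neg, ← mul_inv]
  exact inv_anti₀ (by positivity) (le_sinh hx)

lemma Decays.bddAway {g : ℝ → ℝ} (hg : Decays g) : BddAway g := by
  intro δ hδ
  obtain ⟨C, hC⟩ := hg δ hδ
  refine ⟨|C|, fun x hx => (hC x hx).trans ?_⟩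
  calc C * rexp (-|x|) ≤ |C| * 1 := by
        gcongr
        · exact le_abs_self C
        · simp
    _ = |C| := mul_one _

lemma bddAway_coth : BddAway coth := by
  intro δ hδ
  obtain ⟨C, hC⟩ := decays_csch.bddAway δ hδ
  refine ⟨1 + C, fun x hx => ?_⟩
  have hx0 : x ≠ 0 := by rintro rfl; simp at hx; linarith
  have h1 := hC x hx
  have h2 : |coth x| ^ 2 = 1 + |csch x| ^ 2 := by rw [sq_abs, sq_abs, coth_sq hx0]
  have h3 : 0 ≤ |csch x| := abs_nonneg _
  refine le_of_sq_le_sq ?_ (by linarith)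
  nlinarith

lemma Decays.mul {f g : ℝ → ℝ} (hf : Decays f) (hg : BddAway g) :
    Decays (fun x => f x * g x) := by
  intro δ hδ
  obtain ⟨C, hC⟩ := hf δ hδ
  obtain ⟨D, hD⟩ := hg δ hδ
  refine ⟨C * D, fun x hx => ?_⟩
  rw [abs_mul]
  calc |f x| * |g x| ≤ (C * rexp (-|x|)) * D :=
        mul_le_mul (hC x hx) (hD x hx) (abs_nonneg _) ((abs_nonneg _).trans (hC x hx))
    _ = C * D * rexp (-|x|) := by ring

lemma Decays.add {f g : ℝ → ℝ} (hf : Decays f) (hg : Decays g) :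
    Decays (fun x => f x + g x) := by
  intro δ hδ
  obtain ⟨C, hC⟩ := hf δ hδ
  obtain ⟨D, hD⟩ := hg δ hδ
  refine ⟨C + D, fun x hx => ?_⟩
  have := abs_add_le (f x) (g x)
  have := hC x hx
  have := hD x hx
  linarith

lemma Decays.const_mul {f : ℝ → ℝ} (hf : Decays f) (c : ℝ) : Decays (fun x => c * f x) := by
  have h : BddAway (fun _ => c) := fun δ _ => ⟨|c|, fun x _ => le_rfl⟩
  simpa [mul_comm] using hf.mul h

lemma summable_abs_pow_mul_exp (k : ℕ) {r : ℝ} (hr : 0 < r) :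
    Summable (fun n : ℤ => |(n : ℝ)| ^ k * rexp (-(r * |(n : ℝ)|))) := by
  have h := Real.summable_pow_mul_exp_neg_nat_mul k hr
  refine Summable.of_nat_of_neg ?_ ?_ <;> simpa using h

lemma Decays.bound {g : ℝ → ℝ} (hg : Decays g) {δ : ℝ} (hδ : 0 < δ) :
    ∃ C, ∀ (k : ℕ) (n : ℤ) (y : ℝ), δ ≤ y →
      |(-1 : ℝ) ^ n * (n : ℝ) ^ k * g (n * y)| ≤ C * (|(n : ℝ)| ^ k * rexp (-(δ * |(n : ℝ)|))) := by
  obtain ⟨C, hC⟩ := hg δ hδ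
  have hC0 : 0 ≤ C := by
    have := (abs_nonneg _).trans (hC δ (le_abs_self δ))
    exact nonneg_of_mul_nonneg_left this (Real.exp_pos _)
  refine ⟨C + |g 0|, fun k n y hy => ?_⟩
  have hy0 : 0 < y := hδ.trans_le hy
  rw [abs_mul, abs_mul, abs_pow, abs_zpow, abs_neg, abs_one, one_zpow, one_mul]
  have key : |g (n * y)| ≤ (C + |g 0|) * rexp (-(δ * |(n : ℝ)|)) := by
    rcases eq_or_ne n 0 with rfl | hn
    · simp [hC0]
    · have h1 : (1 : ℝ) ≤ |(n : ℝ)| := by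
        exact_mod_cast Int.one_le_abs hn
      have h2 : δ * |(n : ℝ)| ≤ |n * y| := by
        rw [abs_mul, abs_of_pos hy0]; nlinarith
      refine (hC _ (by nlinarith)).trans ?_
      gcongr
      linarith [abs_nonneg (g 0)]
  calc _ ≤ |(n : ℝ)| ^ k * ((C + |g 0|) * rexp (-(δ * |(n : ℝ)|))) := by gcongr
    _ = _ := by ring

/-- The alternating lattice sum `∑ (-1)^n n^k g(ny)`. -/
noncomputable def altSum (g : ℝ → ℝ) (k : ℕ) (y : ℝ) : ℝ :=
  ∑' n : ℤ, (-1 : ℝ) ^ n * (n : ℝ) ^ k * g (n * y)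

lemma Decays.summable_abs {g : ℝ → ℝ} (hg : Decays g) (k : ℕ) {y : ℝ} (hy : 0 < y) :
    Summable (fun n : ℤ => |(-1 : ℝ) ^ n * (n : ℝ) ^ k * g (n * y)|) := by
  obtain ⟨C, hC⟩ := hg.bound hy
  exact Summable.of_nonneg_of_le (fun _ => abs_nonneg _) (fun n => hC k n y le_rfl)
    ((summable_abs_pow_mul_exp k hy).mul_left C)

lemma Decays.hasSum {g : ℝ → ℝ} (hg : Decays g) (k : ℕ) {y : ℝ} (hy : 0 < y) :
    HasSum (fun n : ℤ => (-1 : ℝ) ^ n * (n : ℝ) ^ k * g (n * y)) (altSum g k y) :=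
  (hg.summable_abs k hy).of_abs.hasSum

lemma altSum_eq_zero {g : ℝ → ℝ} {k : ℕ} (h : ∀ x, (-1) ^ k * g (-x) = -g x) (y : ℝ) :
    altSum g k y = 0 := by
  have h1 : altSum g k y = -altSum g k y := by
    conv_lhs => rw [altSum, ← (Equiv.neg ℤ).tsum_eq]
    rw [altSum, ← tsum_neg]
    congr 1
    ext n
    have : (-1 : ℝ) ^ (-n) = (-1) ^ n := by
      rw [zpow_neg, ← inv_zpow]; norm_num
    simp only [Equiv.neg_apply, Int.cast_neg, this, neg_mul]
    rw [neg_pow]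
    linear_combination (-1 : ℝ) ^ n * (n : ℝ) ^ k * h (n * y)
  linarith

lemma hasDerivAt_altSum {g g' : ℝ → ℝ} (hg : Decays g) (hg' : Decays g')
    (hd : ∀ x ≠ 0, HasDerivAt g (g' x) x) (k : ℕ) {y : ℝ} (hy : 0 < y) :
    HasDerivAt (altSum g k) (altSum g' (k + 1) y) y := by
  obtain ⟨C, hC⟩ := hg'.bound (half_pos hy)
  have hyt : y ∈ Set.Ioi (y / 2) := by simpa using hy
  have hdn : ∀ (n : ℤ), ∀ x ∈ Set.Ioi (y / 2),
      HasDerivAt (fun x => (-1 : ℝ) ^ n * (n : ℝ) ^ k * g (n * x))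
        ((-1 : ℝ) ^ n * (n : ℝ) ^ (k + 1) * g' (n * x)) x := by
    intro n x hx
    have hx0 : 0 < x := (half_pos hy).trans hx
    rcases eq_or_ne n 0 with rfl | hn
    · simpa using hasDerivAt_const x _
    · have hnx : (n : ℝ) * x ≠ 0 := by
        have : (n : ℝ) ≠ 0 := by exact_mod_cast hn
        positivity
      have h1 : HasDerivAt (fun x : ℝ => (n : ℝ) * x) n x := by
        simpa using (hasDerivAt_id x).const_mul (n : ℝ)
      refine (((hd _ hnx).comp x h1).const_mul ((-1 : ℝ) ^ n * (n : ℝ) ^ k)).congr_deriv ?_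
      ring
  exact hasDerivAt_tsum_of_isPreconnected
    ((summable_abs_pow_mul_exp (k + 1) (half_pos hy)).mul_left C) isOpen_Ioi
    isPreconnected_Ioi hdn (fun n x hx => hC (k + 1) n x (le_of_lt hx))
    hyt (hg.hasSum k hy).summable hyt

lemma hasSum_of_eq {ι : Type*} {f g : ι → ℝ} {a b : ℝ} (h : HasSum f a) (hf : ∀ i, g i = f i)
    (hab : b = a) : HasSum g b := by
  rw [hab, funext hf]
  exact h

lemma csch_mul_csch {x y : ℝ} (hx : x ≠ 0) (hy : y ≠ 0) (hxy : x + y ≠ 0) :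
    csch x * csch y = csch (x + y) * (coth x + coth y) := by
  have h1 : Real.sinh x ≠ 0 := by simpa using hx
  have h2 : Real.sinh y ≠ 0 := by simpa using hy
  have h3 : Real.sinh (x + y) ≠ 0 := by simpa using hxy
  unfold csch coth
  field_simp
  rw [Real.sinh_add]
  ring

lemma decays_coth_sub_sign : Decays (fun x => coth x - Real.sign x) := by
  have key : ∀ x : ℝ, 0 < x → coth x - 1 = csch x * rexp (-x) := by
    intro x hx
    have h : Real.sinh x ≠ 0 := by simpa using hx.ne'
    unfold coth csch
    field_simp
    rw [Real.exp_neg, Real.cosh_eq, Real.sinh_eq, Real.exp_neg]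
    ring
  have habs : ∀ x : ℝ, |coth x - Real.sign x| ≤ |csch x| := by
    intro x
    rcases lt_trichotomy x 0 with hx | rfl | hx
    · have := key (-x) (by linarith)
      rw [coth_neg, csch_neg] at this
      rw [Real.sign_of_neg hx, show coth x - -1 = csch x * rexp (- -x) by linarith, abs_mul,
        abs_of_pos (Real.exp_pos _)]
      exact mul_le_of_le_one_right (abs_nonneg _) (Real.exp_le_one_iff.2 (by linarith))
    · simp [coth_zero, csch_zero]
    · rw [Real.sign_of_pos hx, key x hx, abs_mul, abs_of_pos (Real.exp_pos _)]
      exact mul_le_of_le_one_right (abs_nonneg _) (Real.exp_le_one_iff.2 (by linarith))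
  intro δ hδ
  obtain ⟨C, hC⟩ := decays_csch δ hδ
  exact ⟨C, fun x hx => (habs x).trans (hC x hx)⟩

/-- The difference between `coth` and its limits at infinity, along the multiples of `y`. -/
noncomputable def cothRem (y : ℝ) (a : ℤ) : ℝ := coth (a * y) - Real.sign a

lemma summable_pow_mul_cothRem {y : ℝ} (hy : 0 < y) (k : ℕ) :
    Summable (fun a : ℤ => (a : ℝ) ^ k * cothRem y a) := by
  have h := decays_coth_sub_sign.summable_abs k hy
  refine Summable.of_abs (h.congr fun a => ?_)
  have hs : Real.sign ((a : ℝ) * y) = Real.sign a := by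
    rcases lt_trichotomy (a : ℝ) 0 with h | h | h
    · rw [Real.sign_of_neg h, Real.sign_of_neg (mul_neg_of_neg_of_pos h hy)]
    · simp [h]
    · rw [Real.sign_of_pos h, Real.sign_of_pos (mul_pos h hy)]
  rw [hs, cothRem, mul_assoc, abs_mul, abs_zpow, abs_neg, abs_one, one_zpow, one_mul]

/-- The first moment of `cothRem`. -/
noncomputable def cothMoment (y : ℝ) : ℝ := ∑' a : ℤ, (a : ℝ) * cothRem y a

lemma sum_range_mul_sub (N : ℝ) (m : ℕ) :
    ∑ a ∈ Finset.range m, 2 * ((a : ℝ) * (N - a)) =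
      N * (m * (m - 1)) - (m - 1) * m * (2 * m - 1) / 3 := by
  induction m with
  | zero => simp
  | succ m ih => rw [Finset.sum_range_succ, ih]; push_cast; ring

lemma hasSum_sign_sub (n : ℕ) :
    HasSum (fun a : ℤ => Real.sign (a : ℝ) - Real.sign ((a : ℝ) - n)) (2 * n) := by
  induction n with
  | zero => simp
  | succ n ih =>
    have h1 : HasSum (fun a : ℤ => Real.sign (a : ℝ) - Real.sign ((a : ℝ) - 1)) 2 := by
      have := hasSum_sum_of_ne_finset_zero (L := .unconditional ℤ)
        (f := fun a : ℤ => Real.sign (a : ℝ) - Real.sign ((a : ℝ) - 1)) (s := {0, 1}) ?_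
      · convert this using 1
        norm_num [Real.sign]
      · intro a ha
        simp only [Finset.mem_insert, Finset.mem_singleton, not_or] at ha
        rcases lt_or_gt_of_ne ha.1 with h | h
        · have h' : (a : ℝ) < 0 := by exact_mod_cast h
          rw [Real.sign_of_neg h', Real.sign_of_neg (by linarith), sub_self]
        · have h' : (1 : ℝ) < a := by
            have : 1 < a := by omega
            exact_mod_cast this
          rw [Real.sign_of_pos (by linarith), Real.sign_of_pos (by linarith), sub_self]
    have h2 := (Equiv.subRight (n : ℤ)).hasSum_iff.2 h1
    have h3 := ih.add h2
    convert h3 using 1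
    · ext a
      simp only [Function.comp, Equiv.subRight_apply]
      push_cast
      rw [sub_sub (a : ℝ)]
      ring
    · push_cast; ring

lemma hasSum_mul_sign_sub {n : ℕ} (hn : 0 < n) :
    HasSum (fun a : ℤ => (a : ℝ) * (n - a) * (Real.sign (a : ℝ) - Real.sign ((a : ℝ) - n)))
      (((n : ℝ) ^ 3 - n) / 3) := by
  have hn' : (0 : ℝ) < n := by exact_mod_cast hn
  rw [← Function.Injective.hasSum_iff (g := fun m : ℕ => (m : ℤ)) Nat.cast_injective]
  · have h := hasSum_sum_of_ne_finset_zero (L := .unconditional ℕ) (s := Finset.range (n + 1))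
      (f := (fun a : ℤ =>
      (a : ℝ) * (n - a) * (Real.sign (a : ℝ) - Real.sign ((a : ℝ) - n))) ∘ fun m : ℕ => (m : ℤ)) ?_
    · convert h using 1
      have h2 := sum_range_mul_sub n (n + 1)
      push_cast at h2
      rw [show ((n : ℝ) ^ 3 - n) / 3 =
        (n : ℝ) * ((n + 1) * (n + 1 - 1)) - (n + 1 - 1) * (n + 1) * (2 * (n + 1) - 1) / 3 by ring,
        ← h2]
      refine Finset.sum_congr rfl fun a ha => ?_
      have ha' : a ≤ n := by simpa [Nat.lt_succ_iff] using ha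
      simp only [Function.comp, Int.cast_natCast]
      rcases Nat.eq_zero_or_pos a with rfl | h0
      · simp
      rcases ha'.lt_or_eq with h1 | rfl
      · have e1 : (0 : ℝ) < a := by exact_mod_cast h0
        have e2 : (a : ℝ) < n := by exact_mod_cast h1
        rw [Real.sign_of_pos e1, Real.sign_of_neg (by linarith)]
        ring
      · simp
    · intro a ha
      have ha' : (n : ℝ) < a := by
        have : n < a := by simpa [Nat.lt_succ_iff] using ha
        exact_mod_cast this
      simp only [Function.comp, Int.cast_natCast]
      rw [Real.sign_of_pos (hn'.trans ha'), Real.sign_of_pos (by linarith)]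
      ring
  · intro a ha
    have ha' : (a : ℝ) < 0 := by
      have : a < 0 := by
        by_contra h
        exact ha ⟨a.toNat, by simp; omega⟩
      exact_mod_cast this
    rw [Real.sign_of_neg ha', Real.sign_of_neg (by linarith)]
    ring

/-- The Fourier coefficients `(-1)^a csch (ay)`. -/
noncomputable def coef (y : ℝ) (a : ℤ) : ℝ := (-1) ^ a * csch (a * y)

lemma coef_zero (y : ℝ) : coef y 0 = 0 := by simp [coef, csch_zero]

lemma neg_one_zpow_neg (n : ℤ) : (-1 : ℝ) ^ (-n) = (-1) ^ n := by
  rw [zpow_neg, ← inv_zpow]; norm_num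

lemma coef_neg (y : ℝ) (a : ℤ) : coef y (-a) = -coef y a := by
  rw [coef, coef, neg_one_zpow_neg]
  push_cast
  rw [neg_mul, csch_neg]
  ring

lemma coef_mul_coef {y : ℝ} (hy : 0 < y) {a n : ℤ} (ha : a ≠ 0) (han : a ≠ n) (hn : n ≠ 0) :
    coef y a * coef y (n - a) =
      (-1) ^ n * csch (n * y) * (coth (a * y) - coth ((a - n : ℤ) * y)) := by
  have h1 : (a : ℝ) * y ≠ 0 := by
    have : (a : ℝ) ≠ 0 := by exact_mod_cast ha
    positivity
  have h2 : ((n - a : ℤ) : ℝ) * y ≠ 0 := by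
    have : ((n - a : ℤ) : ℝ) ≠ 0 := by exact_mod_cast sub_ne_zero.2 han.symm
    positivity
  have h3 : (a : ℝ) * y + ((n - a : ℤ) : ℝ) * y = n * y := by push_cast; ring
  have h4 : (n : ℝ) * y ≠ 0 := by
    have : (n : ℝ) ≠ 0 := by exact_mod_cast hn
    positivity
  have h5 := csch_mul_csch h1 h2 (by rw [h3]; exact h4)
  rw [h3] at h5
  have h6 : ((a - n : ℤ) : ℝ) * y = -(((n - a : ℤ) : ℝ) * y) := by push_cast; ring
  have h7 : (-1 : ℝ) ^ a * (-1) ^ (n - a) = (-1) ^ n := by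
    rw [← zpow_add₀ (by norm_num)]; congr 1; ring
  rw [coef, coef, h6, coth_neg, sub_neg_eq_add]
  linear_combination ((-1 : ℝ) ^ a * (-1) ^ (n - a)) * h5 +
    csch (n * y) * (coth (a * y) + coth ((n - a : ℤ) * y)) * h7

lemma hasSum_coth_sub {y : ℝ} (hy : 0 < y) (n : ℕ) :
    HasSum (fun a : ℤ => coth (a * y) - coth ((a - n : ℤ) * y)) (2 * n) := by
  have hs : Summable (cothRem y) := by simpa using summable_pow_mul_cothRem hy 0
  have h1 := hs.hasSum
  have h2 := (Equiv.subRight (n : ℤ)).hasSum_iff.2 h1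
  have h3 := (hasSum_sign_sub n).add (h1.sub h2)
  convert h3 using 1
  · ext a
    simp only [Function.comp, Equiv.subRight_apply, cothRem]
    push_cast
    ring
  · ring

lemma hasSum_mul_coth_sub {y : ℝ} (hy : 0 < y) {n : ℕ} (hn : 0 < n) :
    HasSum (fun a : ℤ => (a : ℝ) * (n - a) * (coth (a * y) - coth ((a - n : ℤ) * y)))
      (((n : ℝ) ^ 3 - n) / 3 + 2 * n * cothMoment y) := by
  have h1 : HasSum (fun a : ℤ => (a : ℝ) * cothRem y a) (cothMoment y) := by
    have : Summable (fun a : ℤ => (a : ℝ) * cothRem y a) := by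
      simpa using summable_pow_mul_cothRem hy 1
    exact this.hasSum
  have h2 := (summable_pow_mul_cothRem hy 2).hasSum
  have h3 := (h1.mul_left (n : ℝ)).sub h2
  have h4 := (Equiv.subRight (n : ℤ)).hasSum_iff.2 ((h1.mul_left (n : ℝ)).add h2)
  have h5 := (hasSum_mul_sign_sub hn).add (h3.add h4)
  convert h5 using 1
  · ext a
    simp only [Function.comp, Equiv.subRight_apply, cothRem]
    push_cast
    ring
  · ring

lemma hasSum_conv_nat {y : ℝ} (hy : 0 < y) {n : ℕ} (hn : 0 < n) :
    HasSum (fun a : ℤ => coef y a * coef y (n - a))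
      ((-1) ^ (n : ℤ) * csch (n * y) * (2 * n - 2 * coth (n * y))) := by
  have hn' : (n : ℤ) ≠ 0 := by exact_mod_cast hn.ne'
  have h1 := (hasSum_ite_eq (0 : ℤ) (coth (n * y))).add (hasSum_ite_eq (n : ℤ) (coth (n * y)))
  have h2 := ((hasSum_coth_sub hy n).sub h1).mul_left ((-1) ^ (n : ℤ) * csch (n * y))
  refine hasSum_of_eq h2 (fun a => ?_) (by ring)
  · rcases eq_or_ne a 0 with rfl | ha
    · simp [coef_zero, hn'.symm, coth_zero, coth_neg]
    rcases eq_or_ne a n with rfl | han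
    · simp [coef_zero, hn.ne', coth_zero]
    rw [coef_mul_coef hy ha han hn']
    simp [ha, han]

lemma hasSum_mul_conv_nat {y : ℝ} (hy : 0 < y) {n : ℕ} (hn : 0 < n) :
    HasSum (fun a : ℤ => (a * coef y a) * ((n - a : ℤ) * coef y (n - a)))
      ((-1) ^ (n : ℤ) * csch (n * y) * (((n : ℝ) ^ 3 - n) / 3 + 2 * n * cothMoment y)) := by
  have hn' : (n : ℤ) ≠ 0 := by exact_mod_cast hn.ne'
  have h2 := (hasSum_mul_coth_sub hy hn).mul_left ((-1) ^ (n : ℤ) * csch (n * y))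
  refine hasSum_of_eq h2 (fun a => ?_) rfl
  rcases eq_or_ne a 0 with rfl | ha
  · simp
  rcases eq_or_ne a n with rfl | han
  · simp
  have := coef_mul_coef hy ha han hn'
  push_cast at this ⊢
  linear_combination (a : ℝ) * (n - a) * this

lemma hasSum_conv {y : ℝ} (hy : 0 < y) {n : ℤ} (hn : n ≠ 0) :
    HasSum (fun a : ℤ => coef y a * coef y (n - a))
      ((-1) ^ n * csch (n * y) * (2 * n - 2 * coth (n * y))) := by
  obtain ⟨m, rfl | rfl⟩ := n.eq_nat_or_neg
  · simpa using hasSum_conv_nat hy (n := m) (by omega)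
  · have h := (Equiv.neg ℤ).hasSum_iff.2 (hasSum_conv_nat hy (n := m) (by omega))
    convert h using 1
    · ext a
      simp only [Function.comp, Equiv.neg_apply]
      rw [show -(m : ℤ) - a = -(m - -a) by ring, coef_neg y a, coef_neg]
      ring
    · rw [neg_one_zpow_neg]
      push_cast
      rw [neg_mul, csch_neg, coth_neg]
      ring

lemma hasSum_mul_conv {y : ℝ} (hy : 0 < y) {n : ℤ} (hn : n ≠ 0) :
    HasSum (fun a : ℤ => (a * coef y a) * ((n - a : ℤ) * coef y (n - a)))
      ((-1) ^ n * csch (n * y) * (((n : ℝ) ^ 3 - n) / 3 + 2 * n * cothMoment y)) := by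
  obtain ⟨m, rfl | rfl⟩ := n.eq_nat_or_neg
  · simpa using hasSum_mul_conv_nat hy (n := m) (by omega)
  · have h := (Equiv.neg ℤ).hasSum_iff.2 (hasSum_mul_conv_nat hy (n := m) (by omega))
    convert h using 1
    · ext a
      simp only [Function.comp, Equiv.neg_apply]
      rw [show -(m : ℤ) - a = -(m - -a) by ring, coef_neg y a, coef_neg]
      push_cast
      ring
    · rw [neg_one_zpow_neg]
      push_cast
      rw [neg_mul, csch_neg]
      ring

lemma hasSum_shear {F : ℤ × ℤ → ℝ} {W C : ℤ → ℝ} {L : ℝ}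
    (h : HasSum (fun p : ℤ × ℤ => W (p.1 + p.2) * F p) L)
    (hs : Summable (fun a : ℤ => F (a, 0 - a)))
    (hc : ∀ n ≠ 0, HasSum (fun a => F (a, n - a)) (C n)) (hC : C 0 = 0) :
    HasSum (fun n => W n * C n) (L - W 0 * ∑' a : ℤ, F (a, 0 - a)) := by
  let e : ℤ × ℤ ≃ ℤ × ℤ :=
    { toFun := fun p => (p.2, p.1 - p.2)
      invFun := fun p => (p.1 + p.2, p.1)
      left_inv := fun p => by ext <;> simp
      right_inv := fun p => by ext <;> simp }
  have h1 := e.hasSum_iff.2 h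
  have h2 := h1.prod_fiberwise
    (g := fun n => W n * C n + if n = 0 then W 0 * ∑' a : ℤ, F (a, 0 - a) else 0) (fun n => by
      simp only [Function.comp, e, Equiv.coe_fn_mk, add_sub_cancel]
      rcases eq_or_ne n 0 with rfl | hn
      · simpa [hC] using hs.hasSum.mul_left (W 0)
      · simpa [hn] using (hc n hn).mul_left (W n))
  refine hasSum_of_eq (h2.sub (hasSum_ite_eq (0 : ℤ) (W 0 * ∑' a : ℤ, F (a, 0 - a))))
    (fun n => ?_) rfl
  ring

lemma hasSum_pow_mul_coef {y : ℝ} (hy : 0 < y) (k : ℕ) :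
    HasSum (fun a : ℤ => (a : ℝ) ^ k * coef y a) (altSum csch k y) :=
  hasSum_of_eq (decays_csch.hasSum k hy) (fun a => by rw [coef]; ring) rfl

lemma summable_abs_pow_mul_coef {y : ℝ} (hy : 0 < y) (k : ℕ) :
    Summable (fun a : ℤ => ‖(a : ℝ) ^ k * coef y a‖) :=
  (decays_csch.summable_abs k hy).congr (fun a => by rw [coef, Real.norm_eq_abs]; ring_nf)

lemma hasSum_pow_mul_coef_mul {y : ℝ} (hy : 0 < y) (i j : ℕ) :
    HasSum (fun p : ℤ × ℤ => ((p.1 : ℝ) ^ i * coef y p.1) * ((p.2 : ℝ) ^ j * coef y p.2))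
      (altSum csch i y * altSum csch j y) := by
  have hs := summable_mul_of_summable_norm (f := fun a : ℤ => (a : ℝ) ^ i * coef y a)
    (g := fun a : ℤ => (a : ℝ) ^ j * coef y a) (summable_abs_pow_mul_coef hy i)
    (summable_abs_pow_mul_coef hy j)
  exact (hasSum_pow_mul_coef hy i).mul (hasSum_pow_mul_coef hy j) hs

lemma altSum_csch_even {k : ℕ} (hk : Even k) (y : ℝ) : altSum csch k y = 0 :=
  altSum_eq_zero (fun x => by rw [hk.neg_one_pow, csch_neg, one_mul]) y

lemma summable_antidiagonal {y : ℝ} (hy : 0 < y) (i : ℕ) :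
    Summable (fun a : ℤ =>
      ((a : ℝ) ^ i * coef y a) * (((0 - a : ℤ) : ℝ) ^ i * coef y (0 - a))) :=
  (hasSum_pow_mul_coef_mul hy i i).summable.comp_injective
    (i := fun a : ℤ => ((a, 0 - a) : ℤ × ℤ)) (fun _ _ h => (Prod.mk.inj h).1)

/-- The first derivative of `csch`. -/
noncomputable def csch₁ (x : ℝ) : ℝ := -(csch x * coth x)

lemma decays_csch₁ : Decays csch₁ := by
  have h : csch₁ = fun x => -1 * (csch x * coth x) := by ext x; rw [csch₁]; ring
  rw [h]
  exact (decays_csch.mul bddAway_coth).const_mul (-1)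

lemma hasDerivAt_altSum_csch (k : ℕ) {y : ℝ} (hy : 0 < y) :
    HasDerivAt (altSum csch k) (altSum csch₁ (k + 1) y) y :=
  hasDerivAt_altSum decays_csch decays_csch₁ (fun _ => hasDerivAt_csch) k hy

lemma eq_of_hasSum_pow_conv {y : ℝ} (hy : 0 < y) {k : ℕ} (hk : k ≠ 0) {L : ℝ}
    (h : HasSum (fun p : ℤ × ℤ => ((p.1 + p.2 : ℤ) : ℝ) ^ k * (coef y p.1 * coef y p.2)) L) :
    L = 2 * altSum csch (k + 1) y + 2 * altSum csch₁ k y := by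
  have h1 := hasSum_shear (W := fun n => (n : ℝ) ^ k) (F := fun p => coef y p.1 * coef y p.2) h
    (by simpa using summable_antidiagonal hy 0) (fun n hn => hasSum_conv hy hn)
    (by simp [csch_zero])
  simp only [Int.cast_zero, zero_pow hk, zero_mul, sub_zero] at h1
  refine h1.unique (hasSum_of_eq (((decays_csch.hasSum (k + 1) hy).mul_left 2).add
    ((decays_csch₁.hasSum k hy).mul_left 2)) (fun n => ?_) rfl)
  rw [csch₁]
  ring

lemma eq_of_hasSum_pow_mul_conv {y : ℝ} (hy : 0 < y) {k : ℕ} (hk : k ≠ 0) {L : ℝ}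
    (h : HasSum (fun p : ℤ × ℤ => ((p.1 + p.2 : ℤ) : ℝ) ^ k *
      ((p.1 * coef y p.1) * (p.2 * coef y p.2))) L) :
    L = altSum csch (k + 3) y / 3 + (2 * cothMoment y - 1 / 3) * altSum csch (k + 1) y := by
  have h1 := hasSum_shear (W := fun n => (n : ℝ) ^ k)
    (F := fun p => (p.1 * coef y p.1) * (p.2 * coef y p.2)) h
    (by simpa using summable_antidiagonal hy 1) (fun n hn => hasSum_mul_conv hy hn)
    (by simp [csch_zero])
  simp only [Int.cast_zero, zero_pow hk, zero_mul, sub_zero] at h1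
  refine h1.unique (hasSum_of_eq (((decays_csch.hasSum (k + 3) hy).mul_left (1 / 3)).add
    ((decays_csch.hasSum (k + 1) hy).mul_left (2 * cothMoment y - 1 / 3))) (fun n => ?_) (by ring))
  ring

lemma altSum_csch₁_two {y : ℝ} (hy : 0 < y) :
    altSum csch₁ 2 y = altSum csch 1 y ^ 2 - altSum csch 3 y := by
  have h := eq_of_hasSum_pow_conv hy two_ne_zero (hasSum_of_eq
    (((hasSum_pow_mul_coef_mul hy 2 0).add ((hasSum_pow_mul_coef_mul hy 1 1).mul_left 2)).add
      (hasSum_pow_mul_coef_mul hy 0 2)) (fun p => by push_cast; ring) rfl)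
  simp only [altSum_csch_even even_two, altSum_csch_even Even.zero] at h
  linarith

lemma altSum_csch₁_four {y : ℝ} (hy : 0 < y) :
    altSum csch₁ 4 y = 4 * altSum csch 1 y * altSum csch 3 y - altSum csch 5 y := by
  have h := eq_of_hasSum_pow_conv hy four_ne_zero (hasSum_of_eq
    (((((hasSum_pow_mul_coef_mul hy 4 0).add ((hasSum_pow_mul_coef_mul hy 3 1).mul_left 4)).add
      ((hasSum_pow_mul_coef_mul hy 2 2).mul_left 6)).add
      ((hasSum_pow_mul_coef_mul hy 1 3).mul_left 4)).add
      (hasSum_pow_mul_coef_mul hy 0 4)) (fun p => by push_cast; ring) rfl)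
  simp only [altSum_csch_even even_two, altSum_csch_even Even.zero] at h
  linarith

lemma altSum_csch₁_six {y : ℝ} (hy : 0 < y) :
    altSum csch₁ 6 y = 6 * altSum csch 1 y * altSum csch 5 y + 10 * altSum csch 3 y ^ 2
      - altSum csch 7 y := by
  have h := eq_of_hasSum_pow_conv hy (k := 6) (by norm_num) (hasSum_of_eq
    (((((((hasSum_pow_mul_coef_mul hy 6 0).add
      ((hasSum_pow_mul_coef_mul hy 5 1).mul_left 6)).add
      ((hasSum_pow_mul_coef_mul hy 4 2).mul_left 15)).add
      ((hasSum_pow_mul_coef_mul hy 3 3).mul_left 20)).add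
      ((hasSum_pow_mul_coef_mul hy 2 4).mul_left 15)).add
      ((hasSum_pow_mul_coef_mul hy 1 5).mul_left 6)).add
      (hasSum_pow_mul_coef_mul hy 0 6)) (fun p => by push_cast; ring) rfl)
  simp only [altSum_csch_even even_two, altSum_csch_even Even.zero] at h
  linarith

lemma altSum_csch_five {y : ℝ} (hy : 0 < y) :
    altSum csch 5 y =
      (6 * altSum csch 1 y - 6 * cothMoment y + 1) * altSum csch 3 y := by
  have h := eq_of_hasSum_pow_mul_conv hy two_ne_zero (hasSum_of_eq
    (((hasSum_pow_mul_coef_mul hy 3 1).add ((hasSum_pow_mul_coef_mul hy 2 2).mul_left 2)).add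
      (hasSum_pow_mul_coef_mul hy 1 3)) (fun p => by push_cast; ring) rfl)
  simp only [altSum_csch_even even_two] at h
  linarith

lemma altSum_csch_seven {y : ℝ} (hy : 0 < y) :
    altSum csch 7 y =
      (6 * altSum csch 1 y - 6 * cothMoment y + 1) * altSum csch 5 y
        + 18 * altSum csch 3 y ^ 2 := by
  have h := eq_of_hasSum_pow_mul_conv hy four_ne_zero (hasSum_of_eq
    (((((hasSum_pow_mul_coef_mul hy 5 1).add ((hasSum_pow_mul_coef_mul hy 4 2).mul_left 4)).add
      ((hasSum_pow_mul_coef_mul hy 3 3).mul_left 6)).add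
      ((hasSum_pow_mul_coef_mul hy 2 4).mul_left 4)).add
      (hasSum_pow_mul_coef_mul hy 1 5)) (fun p => by push_cast; ring) rfl)
  simp only [altSum_csch_even even_two] at h
  linarith

lemma hasSum_nat_altSum {g : ℝ → ℝ} (hg : Decays g) {k : ℕ} (hk : k ≠ 0)
    (h : ∀ x, (-1) ^ k * g (-x) = g x) {y : ℝ} (hy : 0 < y) :
    HasSum (fun n : ℕ => (-1 : ℝ) ^ n * (n : ℝ) ^ k * g (n * y)) (altSum g k y / 2) := by
  have h1 := hg.hasSum k hy
  have h2 : Summable (fun n : ℕ => (-1 : ℝ) ^ n * (n : ℝ) ^ k * g (n * y)) := by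
    refine (h1.summable.comp_injective (i := fun n : ℕ => (n : ℤ)) Nat.cast_injective).congr
      fun n => ?_
    simp [Function.comp]
  have h3 := HasSum.of_nat_of_neg
    (f := fun n : ℤ => (-1 : ℝ) ^ n * (n : ℝ) ^ k * g (n * y))
    (hasSum_of_eq h2.hasSum (fun n => by simp) rfl) (hasSum_of_eq h2.hasSum (fun n => by
      rw [neg_one_zpow_neg]
      push_cast
      rw [neg_pow, neg_mul (n : ℝ) y, ← h (n * y), zpow_natCast]
      ring) rfl)
  have h4 := h1.unique h3
  simp only [Int.cast_zero, zero_pow hk, mul_zero, zero_mul, sub_zero] at h4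
  rw [h4, add_self_div_two]
  exact h2.hasSum

lemma hasSum_csch {x : ℝ} (hx : 0 < x) :
    HasSum (fun m : ℕ => 2 * rexp (-((2 * m + 1) * x))) (csch x) := by
  have h1 : rexp (-(2 * x)) < 1 := Real.exp_lt_one_iff.2 (by linarith)
  have h2 := (hasSum_geometric_of_lt_one (Real.exp_pos _).le h1).mul_left (2 * rexp (-x))
  refine hasSum_of_eq h2 (fun m => ?_) ?_
  · rw [← Real.exp_nat_mul, mul_assoc, ← Real.exp_add]
    ring_nf
  · have h3 : rexp (-(2 * x)) = rexp (-x) * rexp (-x) := by rw [← Real.exp_add]; ring_nf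
    have h4 : rexp x * rexp (-x) = 1 := by rw [← Real.exp_add]; simp
    have h5 : Real.sinh x ≠ 0 := by simpa using hx.ne'
    have h6 : 1 - rexp (-(2 * x)) ≠ 0 := by linarith
    unfold csch
    field_simp
    rw [Real.sinh_eq, h3]
    linear_combination -h4

/-- The terms of the Eisenstein series over the points of a rectangular lattice with both
coordinates odd. -/
noncomputable def oddLatticeTerm (k : ℕ) (t : ℝ) (p : ℤ × ℤ) : ℂ :=
  1 / (((2 * p.2 + 1 : ℤ) : ℂ) + ((2 * p.1 + 1 : ℤ) : ℂ) * t * Complex.I) ^ k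

/-- Eisenstein sums over the points of a rectangular lattice with both coordinates odd. -/
noncomputable def oddLatticeSum (k : ℕ) (t : ℝ) : ℂ := ∑' p : ℤ × ℤ, oddLatticeTerm k t p

lemma oddLatticeSum_inv (k : ℕ) {t : ℝ} (ht : 0 < t) :
    oddLatticeSum k t⁻¹ = (t * Complex.I) ^ k * oddLatticeSum k t := by
  have ht' : (t : ℂ) ≠ 0 := by exact_mod_cast ht.ne'
  let e : ℤ × ℤ ≃ ℤ × ℤ :=
    { toFun := fun p => (-1 - p.2, p.1)
      invFun := fun p => (p.2, -1 - p.1)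
      left_inv := fun p => by ext <;> simp
      right_inv := fun p => by ext <;> simp }
  rw [oddLatticeSum, oddLatticeSum, ← tsum_mul_left, ← e.tsum_eq]
  congr 1
  ext p
  have h : ((2 * p.1 + 1 : ℤ) : ℂ) + ((2 * (-1 - p.2) + 1 : ℤ) : ℂ) * ((t⁻¹ : ℝ) : ℂ) * Complex.I =
      (((2 * p.2 + 1 : ℤ) : ℂ) + ((2 * p.1 + 1 : ℤ) : ℂ) * t * Complex.I) / (t * Complex.I) := by
    rw [eq_div_iff (mul_ne_zero ht' Complex.I_ne_zero)]
    push_cast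
    field_simp
    linear_combination -(2 * (p.2 : ℂ) + 1) * Complex.I_sq
  simp only [e, Equiv.coe_fn_mk, oddLatticeTerm]
  rw [h, div_pow, one_div_div, mul_one_div]

lemma norm_odd_add_sq (m l : ℤ) (t : ℝ) :
    ‖((2 * l + 1 : ℤ) : ℂ) + ((2 * m + 1 : ℤ) : ℂ) * t * Complex.I‖ ^ 2 =
      (2 * l + 1 : ℝ) ^ 2 + ((2 * m + 1) * t) ^ 2 := by
  rw [← Complex.normSq_eq_norm_sq, Complex.normSq_apply]
  simp
  ring

lemma one_le_odd_sq (l : ℤ) : (1 : ℝ) ≤ (2 * l + 1 : ℝ) ^ 2 := by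
  have h : (1 : ℤ) ≤ (2 * l + 1) ^ 2 := by
    have : (0 : ℤ) < (2 * l + 1) ^ 2 := by
      have : 2 * l + 1 ≠ 0 := by omega
      positivity
    omega
  exact_mod_cast h

lemma summable_one_div_odd_sq : Summable (fun l : ℤ => 1 / (2 * l + 1 : ℝ) ^ 2) := by
  have h := (Real.summable_one_div_int_pow.2 one_lt_two).comp_injective
    (i := fun l : ℤ => 2 * l + 1) (fun a b h => by simpa using h)
  refine h.congr fun l => ?_
  simp

lemma summable_oddLattice {k : ℕ} (hk : 4 ≤ k) {t : ℝ} (ht : 0 < t) :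
    Summable (oddLatticeTerm k t) := by
  have h := (summable_one_div_odd_sq.mul_of_nonneg summable_one_div_odd_sq
    (fun _ => by positivity) (fun _ => by positivity)).mul_left (1 / (4 * t ^ 2))
  refine Summable.of_norm_bounded h fun p => ?_
  have h1 := norm_odd_add_sq p.1 p.2 t
  rw [oddLatticeTerm]
  set z := ((2 * p.2 + 1 : ℤ) : ℂ) + ((2 * p.1 + 1 : ℤ) : ℂ) * t * Complex.I
  have h2 := one_le_odd_sq p.1
  have h3 := one_le_odd_sq p.2
  have hz : 1 ≤ ‖z‖ := by
    have : 1 ≤ ‖z‖ ^ 2 := by rw [h1]; nlinarith [sq_nonneg ((2 * p.1 + 1 : ℝ) * t)]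
    nlinarith [norm_nonneg z]
  rw [norm_div, norm_one, norm_pow, div_mul_div_comm, one_mul, div_mul_div_comm, one_mul]
  refine one_div_le_one_div_of_le (by positivity) ?_
  calc 4 * t ^ 2 * ((2 * p.1 + 1 : ℝ) ^ 2 * (2 * p.2 + 1 : ℝ) ^ 2) ≤ (‖z‖ ^ 2) ^ 2 := by
        rw [h1]
        nlinarith [sq_nonneg ((2 * p.2 + 1 : ℝ) ^ 2 - ((2 * p.1 + 1) * t) ^ 2)]
    _ = ‖z‖ ^ 4 := by ring
    _ ≤ ‖z‖ ^ k := pow_le_pow_right₀ hz hk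

lemma summable_pow_mul_exp_odd {k : ℕ} (hk : k ≠ 0) {y : ℝ} (hy : 0 < y) :
    Summable (fun p : ℕ × ℕ =>
      (-1 : ℝ) ^ p.2 * (p.2 : ℝ) ^ k * rexp (-((2 * p.1 + 1) * (p.2 * y)))) := by
  have h1 := Real.summable_pow_mul_exp_neg_nat_mul k hy
  have h0 := Real.summable_pow_mul_exp_neg_nat_mul 0 hy
  have h := h0.mul_of_nonneg h1 (fun _ => by positivity) (fun _ => by positivity)
  refine Summable.of_norm_bounded h fun p => ?_
  have h2 : (p.1 : ℝ) ^ 0 * rexp (-y * p.1) * ((p.2 : ℝ) ^ k * rexp (-y * p.2)) =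
      (p.2 : ℝ) ^ k * rexp (-y * p.1 + -y * p.2) := by
    rw [Real.exp_add]
    ring
  rw [norm_mul, norm_mul, norm_pow, norm_neg, norm_one, one_pow, one_mul, Real.norm_eq_abs,
    Real.norm_eq_abs, abs_of_nonneg (by positivity), abs_of_pos (Real.exp_pos _)]
  refine le_of_le_of_eq ?_ h2.symm
  rcases Nat.eq_zero_or_pos p.2 with h | h
  · simp [h, hk]
  · have h2 : (1 : ℝ) ≤ p.2 := by exact_mod_cast h
    have h3 : (0 : ℝ) ≤ p.1 := by positivity
    have h4 : (p.1 : ℝ) ≤ p.1 * p.2 := by nlinarith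
    refine mul_le_mul_of_nonneg_left (Real.exp_le_exp.2 ?_) (by positivity)
    nlinarith [mul_le_mul_of_nonneg_right h4 hy.le, mul_nonneg h3 hy.le]

/-- The normalising constant relating `altSum csch` to `oddLatticeSum`. -/
noncomputable def latticeConst (k : ℕ) : ℂ :=
  2 * (k.factorial * (2 / (-2 * π * Complex.I)) ^ (k + 1))

lemma tsum_pow_mul_exp_odd {k : ℕ} (hk : 1 ≤ k) {y : ℝ} (hy : 0 < y) (m : ℕ) :
    ∑' n : ℕ, (((-1 : ℝ) ^ n * (n : ℝ) ^ k * rexp (-((2 * m + 1) * (n * y))) : ℝ) : ℂ) =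
      latticeConst k / 2 * ∑' l : ℤ, oddLatticeTerm (k + 1) (y / π) (m, l) := by
  have hpi : (π : ℂ) ≠ 0 := by exact_mod_cast Real.pi_ne_zero
  set s : ℝ := (2 * m + 1) * y / (2 * π) with hs
  have hs0 : 0 < s := by positivity
  have hs1 : (s : ℂ) * (2 * π) = (2 * m + 1) * y := by
    rw [hs]
    push_cast
    field_simp
  let z : UpperHalfPlane := ⟨1 / 2 + s * Complex.I, by simpa using hs0⟩
  have hz : (z : ℂ) = 1 / 2 + s * Complex.I := rfl
  have h := EisensteinSeries.qExpansion_identity hk z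
  have hq : Complex.exp (2 * π * Complex.I * z) = -((rexp (-((2 * m + 1) * y)) : ℝ) : ℂ) := by
    have h0 : 2 * π * Complex.I * z = π * Complex.I + ((-((2 * m + 1) * y) : ℝ) : ℂ) := by
      rw [hz]
      push_cast
      linear_combination 2 * π * s * Complex.I_sq - hs1
    rw [h0, Complex.exp_add, Complex.exp_pi_mul_I, Complex.ofReal_exp]
    ring
  have h1 : ∀ n : ℕ, (((-1 : ℝ) ^ n * (n : ℝ) ^ k * rexp (-((2 * m + 1) * (n * y))) : ℝ) : ℂ) =
      (n : ℂ) ^ k * Complex.exp (2 * π * Complex.I * z) ^ n := by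
    intro n
    rw [hq, neg_pow ((rexp (-((2 * m + 1) * y)) : ℝ) : ℂ), ← Complex.ofReal_pow,
      ← Real.exp_nat_mul, show (n : ℝ) * -((2 * m + 1) * y) = -((2 * m + 1) * (n * y)) by ring]
    push_cast
    ring
  have h2 : ∀ l : ℤ, oddLatticeTerm (k + 1) (y / π) (m, l) =
      (1 / 2) ^ (k + 1) * (1 / ((z : ℂ) + l) ^ (k + 1)) := by
    intro l
    have h0 : ((2 * l + 1 : ℤ) : ℂ) + ((2 * (m : ℤ) + 1 : ℤ) : ℂ) * ((y / π : ℝ) : ℂ) * Complex.I =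
        2 * ((z : ℂ) + l) := by
      rw [hz, hs]
      push_cast
      field_simp
      ring
    rw [oddLatticeTerm, h0, mul_pow, one_div_pow, one_div_mul_one_div]
  rw [tsum_congr h1, tsum_congr h2, tsum_mul_left, h, latticeConst]
  have h3 : (-2 * (π : ℂ) * Complex.I) ≠ 0 := by simp [hpi]
  have h4 : (k.factorial : ℂ) ≠ 0 := by exact_mod_cast k.factorial_ne_zero
  rw [div_pow, div_pow, one_pow]
  field_simp

lemma hasSum_csch_double {k : ℕ} (hk : k ≠ 0) {y : ℝ} (hy : 0 < y) :
    HasSum (fun n : ℕ => (-1 : ℝ) ^ n * (n : ℝ) ^ k * csch (n * y) / 2)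
      (∑' p : ℕ × ℕ, (-1 : ℝ) ^ p.2 * (p.2 : ℝ) ^ k * rexp (-((2 * p.1 + 1) * (p.2 * y)))) := by
  have hs := (summable_pow_mul_exp_odd hk hy).hasSum
  have hs' : HasSum (fun p : ℕ × ℕ =>
      (-1 : ℝ) ^ p.1 * (p.1 : ℝ) ^ k * rexp (-((2 * p.2 + 1) * (p.1 * y)))) _ :=
    (Equiv.prodComm ℕ ℕ).hasSum_iff.2 hs
  refine hs'.prod_fiberwise fun n => ?_
  rcases Nat.eq_zero_or_pos n with rfl | hn
  · simp [hk]
  · have hn' : (0 : ℝ) < n := by exact_mod_cast hn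
    exact hasSum_of_eq ((hasSum_csch (x := n * y) (by positivity)).mul_left
      ((-1 : ℝ) ^ n * (n : ℝ) ^ k / 2)) (fun m => by ring) (by ring)

lemma oddLatticeTerm_symm {k : ℕ} (hk : Even k) (t : ℝ) (m l : ℤ) :
    oddLatticeTerm k t (-(m + 1), -1 - l) = oddLatticeTerm k t (m, l) := by
  rw [oddLatticeTerm, oddLatticeTerm, ← hk.neg_pow]
  congr 2
  push_cast
  ring

lemma hasSum_oddLattice {k : ℕ} (hk : 4 ≤ k) (heven : Even k) {t : ℝ} (ht : 0 < t) :
    HasSum (fun m : ℕ => ∑' l : ℤ, oddLatticeTerm k t (m, l)) (oddLatticeSum k t / 2) := by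
  have hL := summable_oddLattice hk ht
  have h5 : HasSum (fun m : ℤ => ∑' l : ℤ, oddLatticeTerm k t (m, l)) (oddLatticeSum k t) :=
    hL.hasSum.prod_fiberwise (fun m => (hL.prod_factor m).hasSum)
  have hnat : Summable (fun m : ℕ => ∑' l : ℤ, oddLatticeTerm k t (m, l)) :=
    h5.summable.comp_injective (i := fun n : ℕ => (n : ℤ)) Nat.cast_injective
  have hsymm : ∀ m : ℕ, ∑' l : ℤ, oddLatticeTerm k t (-(m + 1 : ℤ), l) =
      ∑' l : ℤ, oddLatticeTerm k t (m, l) := by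
    intro m
    rw [← (Equiv.subLeft (-1 : ℤ)).tsum_eq]
    exact tsum_congr fun l => oddLatticeTerm_symm heven t m l
  have hneg : HasSum (fun m : ℕ => ∑' l : ℤ, oddLatticeTerm k t (-(m + 1 : ℤ), l))
      (∑' m : ℕ, ∑' l : ℤ, oddLatticeTerm k t (m, l)) := by
    simp only [hsymm]
    exact hnat.hasSum
  have h6 := HasSum.of_nat_of_neg_add_one
    (f := fun m : ℤ => ∑' l : ℤ, oddLatticeTerm k t (m, l)) hnat.hasSum hneg
  rw [h5.unique h6, add_self_div_two]
  exact hnat.hasSum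

lemma altSum_csch_eq_oddLatticeSum {k : ℕ} (hk : 3 ≤ k) (hodd : Odd k) {y : ℝ} (hy : 0 < y) :
    (altSum csch k y : ℂ) = latticeConst k * oddLatticeSum (k + 1) (y / π) := by
  have hk0 : k ≠ 0 := by omega
  have ht : 0 < y / π := by positivity
  have hs := summable_pow_mul_exp_odd hk0 hy
  have h2 := hasSum_nat_altSum decays_csch hk0
    (fun x => by rw [hodd.neg_one_pow, csch_neg]; ring) hy
  have h3 := (hasSum_csch_double hk0 hy).unique (h2.div_const 2)
  have hsC : HasSum (fun p : ℕ × ℕ =>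
      (((-1 : ℝ) ^ p.2 * (p.2 : ℝ) ^ k * rexp (-((2 * p.1 + 1) * (p.2 * y))) : ℝ) : ℂ)) _ :=
    Complex.hasSum_ofReal.2 hs.hasSum
  have h4 : HasSum (fun m : ℕ => ∑' n : ℕ,
      (((-1 : ℝ) ^ n * (n : ℝ) ^ k * rexp (-((2 * m + 1) * (n * y))) : ℝ) : ℂ)) _ :=
    hsC.prod_fiberwise (fun m => (hsC.summable.prod_factor m).hasSum)
  simp only [tsum_pow_mul_exp_odd (show 1 ≤ k by omega) hy] at h4
  have h5 := (hasSum_oddLattice (k := k + 1) (by omega) hodd.add_one ht).mul_left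
    (latticeConst k / 2)
  have h8 := h5.unique h4
  rw [h3] at h8
  push_cast at h8
  linear_combination -4 * h8

lemma altSum_csch_three_inv {t : ℝ} (ht : 0 < t) :
    altSum csch 3 (π * t⁻¹) = t ^ 4 * altSum csch 3 (π * t) := by
  have h1 := altSum_csch_eq_oddLatticeSum le_rfl (by decide : Odd 3)
    (mul_pos Real.pi_pos (inv_pos.2 ht))
  have h2 := altSum_csch_eq_oddLatticeSum le_rfl (by decide : Odd 3) (mul_pos Real.pi_pos ht)
  rw [mul_div_cancel_left₀ _ Real.pi_ne_zero] at h1 h2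
  rw [oddLatticeSum_inv _ ht, mul_pow, Complex.I_pow_four, mul_one] at h1
  have h3 : (altSum csch 3 (π * t⁻¹) : ℂ) = t ^ 4 * altSum csch 3 (π * t) := by
    rw [h1, h2]
    ring
  exact_mod_cast h3

lemma altSum_csch_five_pi : altSum csch 5 π = 0 := by
  have h1 := altSum_csch_eq_oddLatticeSum (by norm_num : 3 ≤ 5) (by decide : Odd 5) Real.pi_pos
  rw [div_self Real.pi_ne_zero] at h1
  have h2 := oddLatticeSum_inv (5 + 1) one_pos
  have h3 : ((1 : ℝ) * Complex.I : ℂ) ^ (5 + 1) = -1 := by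
    rw [Complex.ofReal_one, one_mul, pow_succ, show (5 : ℕ) = 4 + 1 from rfl, pow_succ,
      Complex.I_pow_four, one_mul, Complex.I_mul_I]
  rw [inv_one, h3] at h2
  have h4 : oddLatticeSum (5 + 1) 1 = 0 := by linear_combination h2 / 2
  rw [h4, mul_zero] at h1
  exact_mod_cast h1

lemma altSum_csch₁_four_pi :
    altSum csch₁ 4 π = -(2 / π) * altSum csch 3 π := by
  have hd := hasDerivAt_altSum_csch 3 Real.pi_pos
  have hl : HasDerivAt (fun t : ℝ => altSum csch 3 (π * t⁻¹))
      (altSum csch₁ 4 π * (π * (-1))) 1 := by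
    have h := ((hasDerivAt_inv (one_ne_zero (α := ℝ))).const_mul π)
    refine (HasDerivAt.comp (h₂ := altSum csch 3) (1 : ℝ) (by simpa using hd) h).congr_deriv ?_
    norm_num
  have hr : HasDerivAt (fun t : ℝ => t ^ 4 * altSum csch 3 (π * t))
      (4 * altSum csch 3 π + altSum csch₁ 4 π * π) 1 := by
    have h := (hasDerivAt_id (1 : ℝ)).const_mul π
    have h' := HasDerivAt.comp (h₂ := altSum csch 3) (1 : ℝ) (by simpa using hd) h
    refine ((hasDerivAt_pow 4 (1 : ℝ)).mul h').congr_deriv ?_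
    simp
  have he : (fun t : ℝ => altSum csch 3 (π * t⁻¹)) =ᶠ[nhds 1]
      fun t : ℝ => t ^ 4 * altSum csch 3 (π * t) := by
    filter_upwards [lt_mem_nhds (one_pos (α := ℝ))] with t ht using altSum_csch_three_inv ht
  have h := (hl.congr_of_eventuallyEq he.symm).unique hr
  have hpi := Real.pi_ne_zero
  field_simp
  linear_combination -h / 2

lemma altSum_csch_one_pi_mul : (altSum csch 1 π * 2 * π + 1) * altSum csch 3 π = 0 := by
  have h := altSum_csch₁_four_pi
  rw [altSum_csch₁_four Real.pi_pos, altSum_csch_five_pi] at h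
  have hpi := Real.pi_ne_zero
  field_simp at h
  linear_combination h / 2

lemma sinh_succ_mul_ge {x : ℝ} (hx : 0 ≤ x) (n : ℕ) :
    Real.sinh x * rexp x ^ n ≤ Real.sinh ((n + 1 : ℕ) * x) := by
  induction n with
  | zero => simp
  | succ n ih =>
    have h1 : 0 ≤ Real.sinh x := Real.sinh_nonneg_iff.2 hx
    have h2 := Real.sinh_lt_cosh ((n + 1 : ℕ) * x)
    have h3 : ((n + 1 + 1 : ℕ) : ℝ) * x = (n + 1 : ℕ) * x + x := by push_cast; ring
    rw [h3, Real.sinh_add, pow_succ, ← mul_assoc]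
    have h4 := mul_le_mul_of_nonneg_right ih (Real.exp_pos x).le
    refine h4.trans ?_
    rw [← Real.cosh_add_sinh x, mul_add]
    linarith [mul_le_mul_of_nonneg_right h2.le h1]

lemma twenty_le_exp_pi : 20 ≤ rexp π := by
  have h1 : (2.718 : ℝ) < rexp 1 := by linarith [Real.exp_one_gt_d9]
  have h2 : rexp 1 ^ 3 ≤ rexp π := by
    rw [← Real.exp_nat_mul]
    exact Real.exp_le_exp.2 (by norm_num; exact Real.pi_gt_three.le)
  have h3 : (2.718 : ℝ) ^ 3 ≤ rexp 1 ^ 3 := by gcongr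
  have h4 : (20 : ℝ) ≤ 2.718 ^ 3 := by norm_num
  linarith

lemma cube_add_two_le (n : ℕ) : ((n + 2 : ℕ) : ℝ) ^ 3 ≤ 8 * 4 ^ n := by
  induction n with
  | zero => norm_num
  | succ n ih =>
    have h : (0 : ℝ) ≤ n := by positivity
    have : ((n + 1 + 2 : ℕ) : ℝ) ^ 3 ≤ 4 * ((n + 2 : ℕ) : ℝ) ^ 3 := by
      push_cast
      nlinarith [pow_nonneg h 2, pow_nonneg h 3]
    rw [pow_succ (4 : ℝ)]
    linarith

/-- At `y = π` the alternating series is dominated by its term of index one. -/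
lemma neg_of_hasSum_alternating {x : ℕ → ℝ} {S : ℝ} (hx : ∀ n, |x n| ≤ n * x 1) (h1 : 0 < x 1)
    (h : HasSum (fun n : ℕ => (-1 : ℝ) ^ n * (n : ℝ) ^ 2 * csch (n * π) * x n) S) : S < 0 := by
  have hs : 0 < Real.sinh π := Real.sinh_pos_iff.2 Real.pi_pos
  have h2 := (hasSum_nat_add_iff' 2).2 h
  have hsum : S - ∑ i ∈ Finset.range 2, (-1 : ℝ) ^ i * (i : ℝ) ^ 2 * csch (i * π) * x i =
      S + csch π * x 1 := by
    simp [Finset.sum_range_succ, csch_zero]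
  rw [hsum] at h2
  have hc : 0 < csch π * x 1 := mul_pos (inv_pos.2 hs) h1
  have hg : HasSum (fun n : ℕ => csch π * x 1 * (2 / 5) * (1 / 5 : ℝ) ^ n)
      (csch π * x 1 * (2 / 5) * (1 - 1 / 5)⁻¹) :=
    (hasSum_geometric_of_lt_one (by norm_num) (by norm_num)).mul_left _
  have hb := h2.norm_le_of_bounded hg fun n => by
    have e1 : csch ((n + 2 : ℕ) * π) ≤ csch π * (1 / 20) ^ (n + 1) := by
      have e2 := sinh_succ_mul_ge Real.pi_pos.le (n + 1)
      have e3 : (20 : ℝ) ^ (n + 1) ≤ rexp π ^ (n + 1) := by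
        gcongr
        exact twenty_le_exp_pi
      rw [csch, csch, one_div, inv_pow, ← mul_inv]
      exact inv_anti₀ (by positivity) ((mul_le_mul_of_nonneg_left e3 hs.le).trans e2)
    have e4 : 0 ≤ csch ((n + 2 : ℕ) * π) :=
      inv_nonneg.2 (Real.sinh_nonneg_iff.2 (by positivity))
    rw [norm_mul, norm_mul, norm_mul, norm_pow, norm_neg, norm_one, one_pow, one_mul,
      Real.norm_eq_abs, Real.norm_eq_abs, Real.norm_eq_abs, abs_of_nonneg e4,
      abs_of_nonneg (by positivity)]
    calc ((n + 2 : ℕ) : ℝ) ^ 2 * csch ((n + 2 : ℕ) * π) * |x (n + 2)|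
        ≤ ((n + 2 : ℕ) : ℝ) ^ 2 * (csch π * (1 / 20) ^ (n + 1)) * ((n + 2 : ℕ) * x 1) := by
          have := mul_nonneg (inv_nonneg.2 hs.le) (pow_nonneg (by norm_num : (0 : ℝ) ≤ 1 / 20)
            (n + 1))
          exact mul_le_mul (mul_le_mul_of_nonneg_left e1 (by positivity)) (hx _) (abs_nonneg _)
            (mul_nonneg (by positivity) this)
      _ = ((n + 2 : ℕ) : ℝ) ^ 3 * (csch π * x 1 * (1 / 20) ^ (n + 1)) := by ring
      _ ≤ 8 * 4 ^ n * (csch π * x 1 * (1 / 20) ^ (n + 1)) := by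
          gcongr
          exact cube_add_two_le n
      _ = csch π * x 1 * (2 / 5) * (1 / 5 : ℝ) ^ n := by
          rw [show (1 / 5 : ℝ) = 4 * (1 / 20) by norm_num, mul_pow]
          ring
  rw [Real.norm_eq_abs] at hb
  have := le_abs_self (S + csch π * x 1)
  norm_num at hb
  linarith

lemma altSum_csch_three_pi_neg : altSum csch 3 π < 0 := by
  have h := hasSum_nat_altSum decays_csch (k := 3) (by norm_num)
    (fun x => by rw [csch_neg]; ring) Real.pi_pos
  have := neg_of_hasSum_alternating (x := fun n => n) (fun n => by simp) (by simp)
    (hasSum_of_eq h (fun n => by ring) rfl)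
  linarith

lemma altSum_csch_one_pi : altSum csch 1 π = -(1 / (2 * π)) := by
  have h := (mul_eq_zero.1 altSum_csch_one_pi_mul).resolve_right altSum_csch_three_pi_neg.ne
  have := Real.pi_ne_zero
  field_simp
  linarith

lemma cothMoment_pi : 6 * altSum csch 1 π - 6 * cothMoment π + 1 = 0 := by
  have h := altSum_csch_five Real.pi_pos
  rw [altSum_csch_five_pi] at h
  exact (mul_eq_zero.1 h.symm).resolve_right altSum_csch_three_pi_neg.ne

/-- The cosine series with coefficients `n ^ k * coef π n`. -/
noncomputable def cosSum (k : ℕ) (u : ℝ) : ℝ :=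
  ∑' n : ℤ, (n : ℝ) ^ k * coef π n * Real.cos (n * u)

/-- The sine series with coefficients `n ^ k * coef π n`. -/
noncomputable def sinSum (k : ℕ) (u : ℝ) : ℝ :=
  ∑' n : ℤ, (n : ℝ) ^ k * coef π n * Real.sin (n * u)

lemma summable_abs_cosSum (k : ℕ) (u : ℝ) :
    Summable (fun n : ℤ => ‖(n : ℝ) ^ k * coef π n * Real.cos (n * u)‖) := by
  refine (summable_abs_pow_mul_coef Real.pi_pos k).of_nonneg_of_le (fun _ => norm_nonneg _)
    fun n => ?_
  rw [norm_mul]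
  exact mul_le_of_le_one_right (norm_nonneg _) (Real.abs_cos_le_one _)

lemma summable_abs_sinSum (k : ℕ) (u : ℝ) :
    Summable (fun n : ℤ => ‖(n : ℝ) ^ k * coef π n * Real.sin (n * u)‖) := by
  refine (summable_abs_pow_mul_coef Real.pi_pos k).of_nonneg_of_le (fun _ => norm_nonneg _)
    fun n => ?_
  rw [norm_mul]
  exact mul_le_of_le_one_right (norm_nonneg _) (Real.abs_sin_le_one _)

lemma hasDerivAt_cosSum (k : ℕ) (u : ℝ) : HasDerivAt (cosSum k) (-sinSum (k + 1) u) u := by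
  have h1 : ∀ (n : ℤ) (v : ℝ), HasDerivAt (fun v => (n : ℝ) ^ k * coef π n * Real.cos (n * v))
      (-((n : ℝ) ^ (k + 1) * coef π n * Real.sin (n * v))) v := by
    intro n v
    refine (((hasDerivAt_id v).const_mul (n : ℝ)).cos.const_mul _).congr_deriv ?_
    simp only [id]
    ring
  have h2 : ∀ (n : ℤ) (v : ℝ), ‖-((n : ℝ) ^ (k + 1) * coef π n * Real.sin (n * v))‖ ≤
      ‖(n : ℝ) ^ (k + 1) * coef π n‖ := by
    intro n v
    rw [norm_neg, norm_mul]
    exact mul_le_of_le_one_right (norm_nonneg _) (Real.abs_sin_le_one _)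
  have h := hasDerivAt_tsum (summable_abs_pow_mul_coef Real.pi_pos (k + 1)) h1 h2
    (summable_abs_cosSum k 0).of_norm u
  rwa [tsum_neg] at h

lemma hasDerivAt_sinSum (k : ℕ) (u : ℝ) : HasDerivAt (sinSum k) (cosSum (k + 1) u) u := by
  have h1 : ∀ (n : ℤ) (v : ℝ), HasDerivAt (fun v => (n : ℝ) ^ k * coef π n * Real.sin (n * v))
      ((n : ℝ) ^ (k + 1) * coef π n * Real.cos (n * v)) v := by
    intro n v
    refine (((hasDerivAt_id v).const_mul (n : ℝ)).sin.const_mul _).congr_deriv ?_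
    simp only [id]
    ring
  have h2 : ∀ (n : ℤ) (v : ℝ), ‖(n : ℝ) ^ (k + 1) * coef π n * Real.cos (n * v)‖ ≤
      ‖(n : ℝ) ^ (k + 1) * coef π n‖ := by
    intro n v
    rw [norm_mul]
    exact mul_le_of_le_one_right (norm_nonneg _) (Real.abs_cos_le_one _)
  exact hasDerivAt_tsum (summable_abs_pow_mul_coef Real.pi_pos (k + 1)) h1 h2
    (summable_abs_sinSum k 0).of_norm u

lemma cosSum_zero (k : ℕ) : cosSum k 0 = altSum csch k π := by
  rw [← (hasSum_pow_mul_coef Real.pi_pos k).tsum_eq]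
  simp [cosSum]

lemma sinSum_zero (k : ℕ) : sinSum k 0 = 0 := by simp [sinSum]

lemma sinSum_pi (k : ℕ) : sinSum k π = 0 := by simp [sinSum, Real.sin_int_mul_pi]

lemma sinSum_one (u : ℝ) : sinSum 1 u = 0 := by
  have h := (Equiv.neg ℤ).tsum_eq (fun n : ℤ => (n : ℝ) ^ 1 * coef π n * Real.sin (n * u))
  have h2 : ∀ n : ℤ, ((Equiv.neg ℤ n : ℤ) : ℝ) ^ 1 * coef π (Equiv.neg ℤ n) *
      Real.sin ((Equiv.neg ℤ n : ℤ) * u) = -((n : ℝ) ^ 1 * coef π n * Real.sin (n * u)) := by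
    intro n
    rw [Equiv.neg_apply, coef_neg, Int.cast_neg, neg_mul (n : ℝ) u, Real.sin_neg]
    ring
  rw [tsum_congr h2, tsum_neg] at h
  rw [sinSum]
  linarith

lemma hasSum_cos_mul_coef_mul (u : ℝ) :
    HasSum (fun p : ℤ × ℤ => Real.cos ((p.1 + p.2 : ℤ) * u) *
      (((p.1 : ℝ) * coef π p.1) * ((p.2 : ℝ) * coef π p.2))) (cosSum 1 u ^ 2) := by
  have hcos : HasSum (fun p : ℤ × ℤ => ((p.1 : ℝ) ^ 1 * coef π p.1 * Real.cos (p.1 * u)) *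
      ((p.2 : ℝ) ^ 1 * coef π p.2 * Real.cos (p.2 * u))) (cosSum 1 u * cosSum 1 u) := by
    have hs := summable_mul_of_summable_norm (summable_abs_cosSum 1 u) (summable_abs_cosSum 1 u)
    have h := (summable_abs_cosSum 1 u).of_norm.hasSum
    exact h.mul h hs
  have hsin : HasSum (fun p : ℤ × ℤ => ((p.1 : ℝ) ^ 1 * coef π p.1 * Real.sin (p.1 * u)) *
      ((p.2 : ℝ) ^ 1 * coef π p.2 * Real.sin (p.2 * u))) (sinSum 1 u * sinSum 1 u) := by
    have hs := summable_mul_of_summable_norm (summable_abs_sinSum 1 u) (summable_abs_sinSum 1 u)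
    have h := (summable_abs_sinSum 1 u).of_norm.hasSum
    exact h.mul h hs
  refine hasSum_of_eq (hcos.sub hsin) (fun p => ?_) (by rw [sinSum_one]; ring)
  push_cast
  rw [add_mul, Real.cos_add]
  ring

lemma cosSum_sq : ∃ c : ℝ, ∀ u, cosSum 1 u ^ 2 - c =
    cosSum 3 u / 3 + 2 * altSum csch 1 π * cosSum 1 u := by
  refine ⟨∑' a : ℤ, ((a : ℝ) * coef π a) * (((0 - a : ℤ) : ℝ) * coef π (0 - a)), fun u => ?_⟩
  have hs : Summable fun a : ℤ => ((a : ℝ) * coef π a) * (((0 - a : ℤ) : ℝ) * coef π (0 - a)) :=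
    (summable_antidiagonal Real.pi_pos 1).congr fun a => by rw [pow_one, pow_one]
  have h := hasSum_shear (W := fun n => Real.cos (n * u))
    (F := fun p => ((p.1 : ℝ) * coef π p.1) * ((p.2 : ℝ) * coef π p.2))
    (C := fun n => (-1) ^ n * csch (n * π) * (((n : ℝ) ^ 3 - n) / 3 + 2 * n * cothMoment π))
    (hasSum_cos_mul_coef_mul u) hs
    (fun n hn => hasSum_mul_conv Real.pi_pos hn) (by simp [csch_zero])
  have h3 : HasSum (fun n : ℤ => 1 / 3 * ((n : ℝ) ^ 3 * coef π n * Real.cos (n * u)) +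
      (2 * cothMoment π - 1 / 3) * ((n : ℝ) ^ 1 * coef π n * Real.cos (n * u)))
      (1 / 3 * cosSum 3 u + (2 * cothMoment π - 1 / 3) * cosSum 1 u) :=
    ((summable_abs_cosSum 3 u).of_norm.hasSum.mul_left (1 / 3)).add
      ((summable_abs_cosSum 1 u).of_norm.hasSum.mul_left (2 * cothMoment π - 1 / 3))
  have h4 := h.unique (hasSum_of_eq h3 (fun n => by rw [coef]; ring) rfl)
  simp only [Int.cast_zero, zero_mul, Real.cos_zero, one_mul] at h4
  rw [h4]
  linear_combination -(cosSum 1 u) / 3 * cothMoment_pi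

lemma cosSum_three (u : ℝ) :
    cosSum 3 u = 3 * (cosSum 1 u - cosSum 1 0) ^ 2 + altSum csch 3 π := by
  obtain ⟨c, hc⟩ := cosSum_sq
  have h0 := hc 0
  have h1 := hc u
  rw [← cosSum_zero] at h0 h1 ⊢
  linear_combination 3 * h0 - 3 * h1

lemma sinSum_two_sq (u : ℝ) :
    sinSum 2 u ^ 2 = -2 * (cosSum 1 u - cosSum 1 0) ^ 3 -
      2 * altSum csch 3 π * (cosSum 1 u - cosSum 1 0) := by
  let E : ℝ → ℝ := fun u => sinSum 2 u ^ 2 + 2 * (cosSum 1 u - cosSum 1 0) ^ 3 +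
      2 * altSum csch 3 π * (cosSum 1 u - cosSum 1 0)
  have hE : ∀ u, HasDerivAt E 0 u := by
    intro u
    have h1 := (hasDerivAt_cosSum 1 u).sub_const (cosSum 1 0)
    refine ((((hasDerivAt_sinSum 2 u).pow 2).add ((h1.pow 3).const_mul 2)).add
      (h1.const_mul (2 * altSum csch 3 π))).congr_deriv ?_
    norm_num
    rw [cosSum_three]
    ring
  have h := is_const_of_deriv_eq_zero (fun u => (hE u).differentiableAt) (fun u => (hE u).deriv) u 0
  simp only [E, sinSum_zero, sub_self] at h
  linear_combination h

lemma abs_sin_nat_mul_le (n : ℕ) (u : ℝ) : |Real.sin (n * u)| ≤ n * |Real.sin u| := by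
  induction n with
  | zero => simp
  | succ n ih =>
    push_cast
    rw [add_mul, one_mul, Real.sin_add, add_mul, one_mul]
    refine (abs_add_le _ _).trans (add_le_add ?_ ?_)
    · rw [abs_mul]
      exact (mul_le_of_le_one_right (abs_nonneg _) (Real.abs_cos_le_one _)).trans ih
    · rw [abs_mul]
      exact mul_le_of_le_one_left (abs_nonneg _) (Real.abs_cos_le_one _)

lemma sinSum_two_neg {u : ℝ} (h0 : 0 < u) (hpi : u < π) : sinSum 2 u < 0 := by
  have hs := Real.sin_pos_of_pos_of_lt_pi h0 hpi
  have h := (summable_abs_sinSum 2 u).of_norm.hasSum.nat_add_neg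
  rw [← sinSum] at h
  have h1 := neg_of_hasSum_alternating (x := fun n => Real.sin (n * u))
    (fun n => by simpa [abs_of_pos hs] using abs_sin_nat_mul_le n u) (by simpa using hs)
    (hasSum_of_eq (h.div_const 2) (fun n => by
      rw [coef_neg, coef]
      push_cast
      rw [neg_mul (n : ℝ) u, Real.sin_neg, zpow_natCast]
      ring) rfl)
  simp at h1
  linarith

lemma beta_eq_integral {α β : ℝ} (hα : 0 < α) (hβ : 0 < β) :
    ProbabilityTheory.beta α β = ∫ t in Set.Ioo (0 : ℝ) 1, t ^ (α - 1) * (1 - t) ^ (β - 1) := by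
  have h : Complex.betaIntegral α β =
      ((∫ t in (0 : ℝ)..1, t ^ (α - 1) * (1 - t) ^ (β - 1) : ℝ) : ℂ) := by
    rw [Complex.betaIntegral, ← intervalIntegral.integral_ofReal]
    refine intervalIntegral.integral_congr fun t ht => ?_
    rw [Set.uIcc_of_le zero_le_one] at ht
    rw [Complex.ofReal_mul, Complex.ofReal_cpow ht.1, Complex.ofReal_cpow (by linarith [ht.2])]
    push_cast
    rfl
  rw [ProbabilityTheory.beta_eq_betaIntegralReal α β hα hβ, h, Complex.ofReal_re,
    intervalIntegral.integral_of_le zero_le_one, MeasureTheory.integral_Ioc_eq_integral_Ioo]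

lemma beta_quarter_half :
    ProbabilityTheory.beta (1 / 4) (1 / 2) ^ 2 * (2 * π) = Real.Gamma (1 / 4) ^ 4 := by
  have h1 := Real.Gamma_mul_Gamma_one_sub (1 / 4)
  rw [show π * (1 / 4) = π / 4 by ring, Real.sin_pi_div_four] at h1
  have h2 : 0 < Real.Gamma (1 - 1 / 4) := Real.Gamma_pos_of_pos (by norm_num)
  have h3 : Real.Gamma (1 / 2) ^ 2 = π := by
    rw [Real.Gamma_one_half_eq, Real.sq_sqrt Real.pi_pos.le]
  have h4 : (√2 : ℝ) ^ 2 = 2 := Real.sq_sqrt (by norm_num)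
  have h5 : (0 : ℝ) < √2 := by positivity
  rw [ProbabilityTheory.beta, show (1 / 4 + 1 / 2 : ℝ) = 1 - 1 / 4 by norm_num, div_pow, mul_pow, h3,
    div_mul_eq_mul_div, div_eq_iff (by positivity)]
  have h6 : (Real.Gamma (1 / 4) * Real.Gamma (1 - 1 / 4)) ^ 2 = 2 * π ^ 2 := by
    rw [h1]
    field_simp
    linear_combination -h4
  linear_combination -Real.Gamma (1 / 4) ^ 2 * h6

lemma altSum_csch_three_pi : altSum csch 3 π = -(Real.Gamma (1 / 4) ^ 8 / (256 * π ^ 6)) := by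
  set p : ℝ → ℝ := fun u => cosSum 1 u - cosSum 1 0 with hp
  have hd : ∀ u, HasDerivAt p (-sinSum 2 u) u := fun u => (hasDerivAt_cosSum 1 u).sub_const _
  have hcont : Continuous p := continuous_iff_continuousAt.2 fun u => (hd u).continuousAt
  have hp0 : p 0 = 0 := sub_self _
  have hmono : StrictMonoOn p (Set.Icc 0 π) := by
    refine strictMonoOn_of_deriv_pos (convex_Icc 0 π) hcont.continuousOn fun u hu => ?_
    rw [interior_Icc] at hu
    rw [(hd u).deriv]
    linarith [sinSum_two_neg hu.1 hu.2]
  obtain ⟨M, hM⟩ : ∃ M, M = p π := ⟨_, rfl⟩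
  have hMpos : 0 < M := by
    have := hmono (Set.left_mem_Icc.2 Real.pi_pos.le) (Set.right_mem_Icc.2 Real.pi_pos.le)
      Real.pi_pos
    rwa [hp0, ← hM] at this
  have hM2 : altSum csch 3 π = -M ^ 2 := by
    have h : sinSum 2 π ^ 2 = -2 * M ^ 3 - 2 * altSum csch 3 π * M := by
      rw [hM]
      exact sinSum_two_sq π
    rw [sinSum_pi] at h
    have h' : M * (altSum csch 3 π + M ^ 2) = 0 := by linear_combination h / 2
    linarith [(mul_eq_zero.1 h').resolve_left hMpos.ne']
  set f : ℝ → ℝ := fun u => (p u / M) ^ 2 with hf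
  have hfd : ∀ u, HasDerivAt f (2 * (p u / M) * (-sinSum 2 u / M)) u := by
    intro u
    refine (((hd u).div_const M).pow 2).congr_deriv ?_
    norm_num
  have hrange : ∀ u ∈ Set.Ioo 0 π, 0 < p u ∧ p u < M := by
    intro u hu
    have h1 := hmono (Set.left_mem_Icc.2 Real.pi_pos.le) (Set.Ioo_subset_Icc_self hu) hu.1
    have h2 := hmono (Set.Ioo_subset_Icc_self hu) (Set.right_mem_Icc.2 Real.pi_pos.le) hu.2
    rw [hp0] at h1
    rw [← hM] at h2
    exact ⟨h1, h2⟩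
  have hinj : Set.InjOn f (Set.Ioo 0 π) := by
    intro u hu v hv huv
    have h1 := hrange u hu
    have h2 := hrange v hv
    have h3 : p u / M = p v / M :=
      (pow_left_inj₀ (div_pos h1.1 hMpos).le (div_pos h2.1 hMpos).le two_ne_zero).1 huv
    exact hmono.injOn (Set.Ioo_subset_Icc_self hu) (Set.Ioo_subset_Icc_self hv)
      ((div_left_inj' hMpos.ne').1 h3)
  have himage : f '' Set.Ioo 0 π = Set.Ioo 0 1 := by
    refine Set.Subset.antisymm ?_ ?_
    · rintro _ ⟨u, hu, rfl⟩
      have h1 := hrange u hu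
      exact ⟨pow_pos (div_pos h1.1 hMpos) 2,
        pow_lt_one₀ (div_pos h1.1 hMpos).le ((div_lt_one hMpos).2 h1.2) two_ne_zero⟩
    · have hcf : ContinuousOn f (Set.Icc 0 π) := fun u _ => (hfd u).continuousAt.continuousWithinAt
      have h := intermediate_value_Ioo Real.pi_pos.le hcf
      have e0 : f 0 = 0 := by
        rw [hf]
        simp only [hp0, zero_div, ne_eq, two_ne_zero, not_false_eq_true, zero_pow]
      have e1 : f π = 1 := by
        rw [hf]
        simp only [← hM, div_self hMpos.ne', one_pow]
      rwa [e0, e1] at h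
  have hchange := MeasureTheory.integral_image_eq_integral_abs_deriv_smul
    (measurableSet_Ioo (a := 0) (b := π)) (fun u _ => (hfd u).hasDerivWithinAt) hinj
    (fun t => t ^ (1 / 4 - 1 : ℝ) * (1 - t) ^ (1 / 2 - 1 : ℝ))
  have hconst : ∀ u ∈ Set.Ioo 0 π, |2 * (p u / M) * (-sinSum 2 u / M)| •
      (f u ^ (1 / 4 - 1 : ℝ) * (1 - f u) ^ (1 / 2 - 1 : ℝ)) = √(8 * M) := by
    intro u hu
    obtain ⟨h1, h2⟩ := hrange u hu
    set q := p u / M with hq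
    have hq0 : 0 < q := div_pos h1 hMpos
    have hq1 : q < 1 := (div_lt_one hMpos).2 h2
    have hpq : p u = M * q := by rw [hq]; field_simp
    have hs : sinSum 2 u ^ 2 = 2 * M ^ 3 * (q * (1 - q ^ 2)) := by
      have h : sinSum 2 u ^ 2 = -2 * p u ^ 3 - 2 * altSum csch 3 π * p u := sinSum_two_sq u
      rw [h, hM2, hpq]
      ring
    have hfu : f u = q ^ 2 := rfl
    have hq2 : 0 < 1 - q ^ 2 := by nlinarith
    have e1 : ((q ^ 2) ^ (1 / 4 - 1 : ℝ)) ^ 2 = (q ^ 3)⁻¹ := by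
      rw [← Real.rpow_natCast, ← Real.rpow_natCast, ← Real.rpow_mul hq0.le, ← Real.rpow_mul hq0.le,
        ← Real.rpow_natCast q 3, ← Real.rpow_neg hq0.le]
      norm_num
    have e2 : ((1 - q ^ 2) ^ (1 / 2 - 1 : ℝ)) ^ 2 = (1 - q ^ 2)⁻¹ := by
      rw [← Real.rpow_natCast, ← Real.rpow_mul hq2.le, ← Real.rpow_neg_one]
      norm_num
    rw [eq_comm, Real.sqrt_eq_iff_mul_self_eq (by positivity) (by
      rw [hfu, smul_eq_mul]; positivity), smul_eq_mul, ← sq, mul_pow, mul_pow, sq_abs, hfu, e1, e2,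
      mul_pow, div_pow, neg_sq, hs]
    field_simp
    ring
  rw [himage, MeasureTheory.setIntegral_congr_fun measurableSet_Ioo hconst,
    ← beta_eq_integral (by norm_num) (by norm_num)] at hchange
  have hval : ProbabilityTheory.beta (1 / 4) (1 / 2) = π * √(8 * M) := by
    rw [hchange]
    simp [Real.pi_pos.le]
  have h := beta_quarter_half
  rw [hval, mul_pow, Real.sq_sqrt (by positivity)] at h
  have hpi := Real.pi_ne_zero
  rw [hM2, show Real.Gamma (1 / 4) ^ 8 = (Real.Gamma (1 / 4) ^ 4) ^ 2 by ring, ← h]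
  field_simp
  norm_num

lemma bddAway_csch_sq : BddAway (fun x => csch x ^ 2) := by
  have h := (decays_csch.mul decays_csch.bddAway).bddAway
  simpa only [← sq] using h

lemma decays_csch_pow_three : Decays (fun x => csch x ^ 3) := by
  have h := decays_csch.mul bddAway_csch_sq
  simpa only [← pow_succ'] using h

lemma decays_csch_pow_five : Decays (fun x => csch x ^ 5) := by
  have h := decays_csch_pow_three.mul bddAway_csch_sq
  simpa only [← pow_add] using h

/-- The second derivative of `csch`. -/
noncomputable def csch₂ (x : ℝ) : ℝ := csch x + 2 * csch x ^ 3

/-- The third derivative of `csch`. -/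
noncomputable def csch₃ (x : ℝ) : ℝ := csch₁ x + 6 * (csch₁ x * csch x ^ 2)

/-- The fourth derivative of `csch`. -/
noncomputable def csch₄ (x : ℝ) : ℝ := csch x + 20 * csch x ^ 3 + 24 * csch x ^ 5

lemma decays_csch₂ : Decays csch₂ := decays_csch.add (decays_csch_pow_three.const_mul 2)

lemma decays_csch₃ : Decays csch₃ :=
  decays_csch₁.add ((decays_csch₁.mul bddAway_csch_sq).const_mul 6)

lemma decays_csch₄ : Decays csch₄ :=
  (decays_csch.add (decays_csch_pow_three.const_mul 20)).add (decays_csch_pow_five.const_mul 24)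

lemma hasDerivAt_csch₁ {x : ℝ} (hx : x ≠ 0) : HasDerivAt csch₁ (csch₂ x) x := by
  refine ((hasDerivAt_csch hx).mul (hasDerivAt_coth hx)).neg.congr_deriv ?_
  rw [csch₂]
  linear_combination csch x * coth_sq hx

lemma hasDerivAt_csch₂ {x : ℝ} (hx : x ≠ 0) : HasDerivAt csch₂ (csch₃ x) x := by
  refine ((hasDerivAt_csch hx).add (((hasDerivAt_csch hx).pow 3).const_mul 2)).congr_deriv ?_
  rw [csch₃, csch₁]
  norm_num
  ring

lemma hasDerivAt_csch₃ {x : ℝ} (hx : x ≠ 0) : HasDerivAt csch₃ (csch₄ x) x := by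
  have h := hasDerivAt_csch₁ hx
  refine (h.add ((h.mul ((hasDerivAt_csch hx).pow 2)).const_mul 6)).congr_deriv ?_
  simp only [csch₂, csch₁, csch₄, Pi.pow_apply]
  norm_num
  linear_combination 12 * csch x ^ 3 * coth_sq hx

/-- The positive arguments at which the logarithmic derivative of `altSum csch 3` makes sense. -/
def regularSet : Set ℝ := {y | 0 < y ∧ altSum csch 3 y ≠ 0}

lemma pi_mem_regularSet : π ∈ regularSet := ⟨Real.pi_pos, altSum_csch_three_pi_neg.ne⟩

lemma regularSet_mem_nhds {y : ℝ} (hy : y ∈ regularSet) : regularSet ∈ nhds y := by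
  have h := (hasDerivAt_altSum_csch 3 hy.1).continuousAt.eventually_ne hy.2
  filter_upwards [h, lt_mem_nhds hy.1] with t ht ht0 using ⟨ht0, ht⟩

/-- The quotient `altSum csch 5 / altSum csch 3` on `regularSet`. -/
noncomputable def altQuot (y : ℝ) : ℝ := 6 * altSum csch 1 y - 6 * cothMoment y + 1

lemma hasDerivAt_altSum_one {y : ℝ} (hy : y ∈ regularSet) :
    HasDerivAt (altSum csch 1) (altSum csch 1 y ^ 2 - altSum csch 3 y) y :=
  (hasDerivAt_altSum_csch 1 hy.1).congr_deriv (altSum_csch₁_two hy.1)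

lemma hasDerivAt_altSum_three {y : ℝ} (hy : y ∈ regularSet) :
    HasDerivAt (altSum csch 3) (altSum csch 3 y * (4 * altSum csch 1 y - altQuot y)) y := by
  refine (hasDerivAt_altSum_csch 3 hy.1).congr_deriv ?_
  rw [altSum_csch₁_four hy.1, altSum_csch_five hy.1, altQuot]
  ring

lemma hasDerivAt_altQuot {y : ℝ} (hy : y ∈ regularSet) :
    HasDerivAt altQuot (2 * altSum csch 1 y * altQuot y - 8 * altSum csch 3 y) y := by
  have h5 : HasDerivAt (altSum csch 5) _ y := hasDerivAt_altSum_csch 5 hy.1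
  rw [altSum_csch₁_six hy.1] at h5
  have he : altQuot =ᶠ[nhds y] fun t => altSum csch 5 t / altSum csch 3 t := by
    filter_upwards [regularSet_mem_nhds hy] with t ht
    rw [eq_div_iff ht.2, altSum_csch_five ht.1, altQuot]
  refine ((h5.div (hasDerivAt_altSum_three hy) hy.2).congr_of_eventuallyEq he).congr_deriv ?_
  have h := hy.2
  rw [altSum_csch_seven hy.1, altSum_csch_five hy.1, ← altQuot]
  field_simp
  ring

lemma altSum_eq_of_hasDerivAt {g g' P P' : ℝ → ℝ} {k : ℕ} (hg : Decays g) (hg' : Decays g')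
    (hd : ∀ x ≠ 0, HasDerivAt g (g' x) x) (h : ∀ y ∈ regularSet, altSum g k y = P y)
    (hP : ∀ y ∈ regularSet, HasDerivAt P (P' y) y) :
    ∀ y ∈ regularSet, altSum g' (k + 1) y = P' y := by
  intro y hy
  have he : altSum g k =ᶠ[nhds y] P := by
    filter_upwards [regularSet_mem_nhds hy] with t ht using h t ht
  exact (hasDerivAt_altSum hg hg' hd k hy.1).unique ((hP y hy).congr_of_eventuallyEq he)

lemma altSum_csch₂_five : ∀ y ∈ regularSet, altSum csch₂ 5 y =
    altSum csch 3 y * (20 * altSum csch 1 y ^ 2 - 10 * altSum csch 1 y * altQuot y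
      + altQuot y ^ 2 + 4 * altSum csch 3 y) := by
  refine altSum_eq_of_hasDerivAt decays_csch₁ decays_csch₂ (fun _ => hasDerivAt_csch₁)
    (P := fun y => altSum csch 3 y * (4 * altSum csch 1 y - altQuot y)) (fun y hy => ?_)
    (fun y hy => ?_)
  · exact (hasDerivAt_altSum_csch 3 hy.1).unique (hasDerivAt_altSum_three hy)
  · refine ((hasDerivAt_altSum_three hy).mul (((hasDerivAt_altSum_one hy).const_mul 4).sub
      (hasDerivAt_altQuot hy))).congr_deriv ?_
    simp only [Pi.sub_apply]
    ring

lemma altSum_csch₃_six : ∀ y ∈ regularSet, altSum csch₃ 6 y =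
    altSum csch 3 y * (120 * altSum csch 1 y ^ 3 + 72 * altSum csch 1 y * altSum csch 3 y
      - 90 * altSum csch 1 y ^ 2 * altQuot y - 14 * altSum csch 3 y * altQuot y
      + 18 * altSum csch 1 y * altQuot y ^ 2 - altQuot y ^ 3) := by
  refine altSum_eq_of_hasDerivAt decays_csch₂ decays_csch₃ (fun _ => hasDerivAt_csch₂)
    altSum_csch₂_five (fun y hy => ?_)
  have h1 := hasDerivAt_altSum_one hy
  have h3 := hasDerivAt_altSum_three hy
  have he := hasDerivAt_altQuot hy
  refine (h3.mul (((((h1.pow 2).const_mul 20).sub ((h1.const_mul 10).mul he)).add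
    (he.pow 2)).add (h3.const_mul 4))).congr_deriv ?_
  simp only [Pi.sub_apply, Pi.add_apply, Pi.mul_apply, Pi.pow_apply]
  norm_num
  ring

lemma altQuot_pi : altQuot π = 0 := cothMoment_pi

lemma altSum_csch₄_seven_pi : altSum csch₄ 7 π =
    840 * altSum csch 1 π ^ 4 * altSum csch 3 π + 1008 * altSum csch 1 π ^ 2 * altSum csch 3 π ^ 2
      + 40 * altSum csch 3 π ^ 3 := by
  have h := altSum_eq_of_hasDerivAt decays_csch₃ decays_csch₄ (fun _ => hasDerivAt_csch₃)
    altSum_csch₃_six (fun y hy => by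
      have h1 := hasDerivAt_altSum_one hy
      have h3 := hasDerivAt_altSum_three hy
      have he := hasDerivAt_altQuot hy
      exact h3.mul (((((((h1.pow 3).const_mul 120).add ((h1.const_mul 72).mul h3)).sub
        (((h1.pow 2).const_mul 90).mul he)).sub ((h3.const_mul 14).mul he)).add
        ((h1.const_mul 18).mul (he.pow 2))).sub (he.pow 3))) π pi_mem_regularSet
  rw [h]
  simp only [Pi.pow_apply, altQuot_pi]
  norm_num
  ring

/-- Up to sign and normalisation, the residue of the integrand at `(1 + i) * t` when
`t` is a multiple of `π`. -/
noncomputable def residueTerm (t : ℝ) : ℝ :=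
  42 * t ^ 5 * csch t ^ 3 - 42 * t ^ 6 * csch t ^ 3 * coth t
    + t ^ 7 * (10 * csch t ^ 3 + 12 * csch t ^ 5)

lemma hasSum_residueTerm :
    HasSum (fun n : ℕ => (-1 : ℝ) ^ n * residueTerm (n * π))
      (21 / 2 * π ^ 5 * altSum csch₂ 5 π + 7 / 2 * π ^ 6 * (altSum csch₃ 6 π - altSum csch₁ 6 π)
        + 1 / 4 * π ^ 7 * (altSum csch₄ 7 π - altSum csch 7 π)) := by
  have hodd₁ : ∀ x, csch₁ (-x) = csch₁ x := fun x => by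
    rw [csch₁, csch₁, csch_neg, coth_neg]
    ring
  have h0 := hasSum_nat_altSum decays_csch (k := 5) (by norm_num)
    (fun x => by rw [csch_neg]; ring) Real.pi_pos
  have h0' := hasSum_nat_altSum decays_csch (k := 7) (by norm_num)
    (fun x => by rw [csch_neg]; ring) Real.pi_pos
  have h1 := hasSum_nat_altSum decays_csch₁ (k := 6) (by norm_num)
    (fun x => by rw [hodd₁]; ring) Real.pi_pos
  have h2 := hasSum_nat_altSum decays_csch₂ (k := 5) (by norm_num)
    (fun x => by rw [csch₂, csch₂, csch_neg]; ring) Real.pi_pos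
  have h3 := hasSum_nat_altSum decays_csch₃ (k := 6) (by norm_num)
    (fun x => by rw [csch₃, csch₃, hodd₁, csch_neg]; ring) Real.pi_pos
  have h4 := hasSum_nat_altSum decays_csch₄ (k := 7) (by norm_num)
    (fun x => by rw [csch₄, csch₄, csch_neg]; ring) Real.pi_pos
  refine hasSum_of_eq ((((h2.sub h0).mul_left (21 * π ^ 5)).add
    ((h3.sub h1).mul_left (7 * π ^ 6))).add ((h4.sub h0').mul_left (1 / 2 * π ^ 7)))
    (fun n => ?_) ?_
  · rw [residueTerm, csch₃, csch₄, csch₂, csch₁]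
    ring
  · rw [altSum_csch_five_pi]
    ring

lemma residueTerm_sum_eq :
    π * (21 / 2 * π ^ 5 * altSum csch₂ 5 π + 7 / 2 * π ^ 6 * (altSum csch₃ 6 π - altSum csch₁ 6 π)
        + 1 / 4 * π ^ 7 * (altSum csch₄ 7 π - altSum csch 7 π)) =
      -(105 * Real.Gamma (1 / 4) ^ 8 / (2 ^ 11 * π ^ 2))
    - 21 * Real.Gamma (1 / 4) ^ 16 / (2 ^ 16 * π ^ 6)
    + 7 * Real.Gamma (1 / 4) ^ 16 / (2 ^ 14 * π ^ 5)
    - 9 * Real.Gamma (1 / 4) ^ 16 / (2 ^ 17 * π ^ 4)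
    - 5 * Real.Gamma (1 / 4) ^ 24 / (2 ^ 23 * π ^ 10) := by
  rw [altSum_csch₄_seven_pi, altSum_csch₃_six π pi_mem_regularSet,
    altSum_csch₂_five π pi_mem_regularSet, altSum_csch₁_six Real.pi_pos,
    altSum_csch_seven Real.pi_pos, altSum_csch_five_pi, altQuot_pi, altSum_csch_one_pi,
    altSum_csch_three_pi]
  have hpi := Real.pi_ne_zero
  field_simp
  ring

/-- The integral of `f` along the positively oriented boundary of the square `[0, R]²`. -/
noncomputable def squareIntegral (f : ℂ → ℂ) (R : ℝ) : ℂ :=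
  (∫ x in (0:ℝ)..R, f x) - (∫ x in (0:ℝ)..R, f (x + R * Complex.I)) +
    Complex.I * (∫ y in (0:ℝ)..R, f (R + y * Complex.I)) -
    Complex.I * (∫ y in (0:ℝ)..R, f (y * Complex.I))

/-- The closed square `[0, R]²` in the complex plane. -/
def closedSquare (R : ℝ) : Set ℂ := {z | (0 ≤ z.re ∧ z.re ≤ R) ∧ 0 ≤ z.im ∧ z.im ≤ R}

/-- The open square `(0, R)²` in the complex plane. -/
def openSquare (R : ℝ) : Set ℂ := {z | (0 < z.re ∧ z.re < R) ∧ 0 < z.im ∧ z.im < R}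

/-- The boundary of the square `[0, R]²`. -/
def squareFrame (R : ℝ) : Set ℂ := closedSquare R \ openSquare R

lemma isOpen_openSquare (R : ℝ) : IsOpen (openSquare R) := by
  have h1 := isOpen_lt (continuous_const (y := (0:ℝ))) Complex.continuous_re
  have h2 := isOpen_lt Complex.continuous_re (continuous_const (y := R))
  have h3 := isOpen_lt (continuous_const (y := (0:ℝ))) Complex.continuous_im
  have h4 := isOpen_lt Complex.continuous_im (continuous_const (y := R))
  exact (h1.inter h2).inter (h3.inter h4)

lemma openSquare_subset (R : ℝ) : openSquare R ⊆ closedSquare R :=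
  fun _ h => ⟨⟨h.1.1.le, h.1.2.le⟩, h.2.1.le, h.2.2.le⟩

lemma bottom_mem_squareFrame {R t : ℝ} (h0 : 0 ≤ t) (hR : t ≤ R) : (t : ℂ) ∈ squareFrame R := by
  simp [squareFrame, closedSquare, openSquare, h0, hR, h0.trans hR]

lemma left_mem_squareFrame {R t : ℝ} (h0 : 0 ≤ t) (hR : t ≤ R) :
    (t * Complex.I : ℂ) ∈ squareFrame R := by
  simp [squareFrame, closedSquare, openSquare, h0, hR, h0.trans hR]

lemma top_mem_squareFrame {R t : ℝ} (h0 : 0 ≤ t) (hR : t ≤ R) :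
    (t + R * Complex.I : ℂ) ∈ squareFrame R := by
  simp [squareFrame, closedSquare, openSquare, h0, hR, h0.trans hR]

lemma right_mem_squareFrame {R t : ℝ} (h0 : 0 ≤ t) (hR : t ≤ R) :
    (R + t * Complex.I : ℂ) ∈ squareFrame R := by
  simp [squareFrame, closedSquare, openSquare, h0, hR, h0.trans hR]

lemma continuousOn_comp_line {f : ℂ → ℂ} {R : ℝ} {a b : ℂ}
    (hf : ∀ t : ℝ, 0 ≤ t → t ≤ R → ContinuousAt f (a + t * b)) :
    ContinuousOn (fun t : ℝ => f (a + t * b)) (Set.Icc 0 R) := by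
  intro t ht
  have h : ContinuousAt (fun t : ℝ => a + t * b) t := by fun_prop
  exact (ContinuousAt.comp (f := fun t : ℝ => a + t * b) (hf t ht.1 ht.2) h).continuousWithinAt

lemma integral_line_eq_sub {F f : ℂ → ℂ} {R : ℝ} (hR : 0 ≤ R) {a b : ℂ}
    (hF : ∀ t : ℝ, 0 ≤ t → t ≤ R → HasDerivAt F (f (a + t * b)) (a + t * b))
    (hf : ∀ t : ℝ, 0 ≤ t → t ≤ R → ContinuousAt f (a + t * b)) :
    b * (∫ t in (0:ℝ)..R, f (a + t * b)) = F (a + R * b) - F a := by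
  rw [← intervalIntegral.integral_const_mul]
  have hd : ∀ t ∈ Set.uIcc 0 R,
      HasDerivAt (fun t : ℝ => F (a + t * b)) (b * f (a + t * b)) t := by
    intro t ht
    rw [Set.uIcc_of_le hR] at ht
    have h1 : HasDerivAt (fun z : ℂ => a + z * b) b (t : ℂ) := by
      simpa using ((hasDerivAt_id (t : ℂ)).mul_const b).const_add a
    have h2 := (HasDerivAt.comp (t : ℂ) (hF t ht.1 ht.2) h1).comp_ofReal
    exact h2.congr_deriv (mul_comm _ _)
  have hc : ContinuousOn (fun t : ℝ => b * f (a + t * b)) (Set.uIcc 0 R) := by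
    rw [Set.uIcc_of_le hR]
    exact continuousOn_const.mul (continuousOn_comp_line hf)
  rw [intervalIntegral.integral_eq_sub_of_hasDerivAt hd hc.intervalIntegrable]
  simp

lemma intervalIntegrable_comp_line {f : ℂ → ℂ} {R : ℝ} (hR : 0 ≤ R) {a b : ℂ}
    (hf : ∀ t : ℝ, 0 ≤ t → t ≤ R → ContinuousAt f (a + t * b)) :
    IntervalIntegrable (fun t : ℝ => f (a + t * b)) MeasureTheory.volume 0 R := by
  refine ContinuousOn.intervalIntegrable ?_
  rw [Set.uIcc_of_le hR]
  exact continuousOn_comp_line hf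

/-- Integrability of a function on each of the four sides of the square. -/
structure SquareIntegrable (f : ℂ → ℂ) (R : ℝ) : Prop where
  bottom : IntervalIntegrable (fun t : ℝ => f t) MeasureTheory.volume 0 R
  top : IntervalIntegrable (fun t : ℝ => f (t + R * Complex.I)) MeasureTheory.volume 0 R
  right : IntervalIntegrable (fun t : ℝ => f (R + t * Complex.I)) MeasureTheory.volume 0 R
  left : IntervalIntegrable (fun t : ℝ => f (t * Complex.I)) MeasureTheory.volume 0 R

lemma SquareIntegrable.of_continuousAt {f : ℂ → ℂ} {R : ℝ} (hR : 0 ≤ R)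
    (hf : ∀ z ∈ squareFrame R, ContinuousAt f z) : SquareIntegrable f R where
  bottom := by
    have := intervalIntegrable_comp_line (f := f) hR (a := 0) (b := 1)
      (fun t h0 h1 => hf _ (by simpa using bottom_mem_squareFrame h0 h1))
    simpa using this
  top := by
    have := intervalIntegrable_comp_line (f := f) hR (a := R * Complex.I) (b := 1)
      (fun t h0 h1 => hf _ (by simpa [add_comm] using top_mem_squareFrame h0 h1))
    simpa [add_comm] using this
  right := intervalIntegrable_comp_line hR (fun t h0 h1 => hf _ (right_mem_squareFrame h0 h1))
  left := by
    have := intervalIntegrable_comp_line (f := f) hR (a := 0) (b := Complex.I)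
      (fun t h0 h1 => hf _ (by simpa using left_mem_squareFrame h0 h1))
    simpa using this

lemma SquareIntegrable.add {f g : ℂ → ℂ} {R : ℝ} (hf : SquareIntegrable f R)
    (hg : SquareIntegrable g R) : SquareIntegrable (fun z => f z + g z) R :=
  ⟨hf.bottom.add hg.bottom, hf.top.add hg.top, hf.right.add hg.right, hf.left.add hg.left⟩

lemma squareIntegral_add {f g : ℂ → ℂ} {R : ℝ} (hf : SquareIntegrable f R)
    (hg : SquareIntegrable g R) :
    squareIntegral (fun z => f z + g z) R = squareIntegral f R + squareIntegral g R := by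
  simp only [squareIntegral]
  rw [intervalIntegral.integral_add hf.bottom hg.bottom,
    intervalIntegral.integral_add hf.top hg.top,
    intervalIntegral.integral_add hf.right hg.right,
    intervalIntegral.integral_add hf.left hg.left]
  ring

lemma squareIntegral_const_mul (c : ℂ) (f : ℂ → ℂ) (R : ℝ) :
    squareIntegral (fun z => c * f z) R = c * squareIntegral f R := by
  simp only [squareIntegral, intervalIntegral.integral_const_mul]
  ring

lemma squareIntegral_congr {f g : ℂ → ℂ} {R : ℝ} (hR : 0 ≤ R)
    (h : ∀ z ∈ squareFrame R, f z = g z) : squareIntegral f R = squareIntegral g R := by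
  simp only [squareIntegral]
  congr 1
  · congr 1
    · congr 1 <;> refine intervalIntegral.integral_congr fun t ht => h _ ?_ <;>
        rw [Set.uIcc_of_le hR] at ht
      · exact bottom_mem_squareFrame ht.1 ht.2
      · exact top_mem_squareFrame ht.1 ht.2
    · congr 1
      refine intervalIntegral.integral_congr fun t ht => h _ ?_
      rw [Set.uIcc_of_le hR] at ht
      exact right_mem_squareFrame ht.1 ht.2
  · congr 1
    refine intervalIntegral.integral_congr fun t ht => h _ ?_
    rw [Set.uIcc_of_le hR] at ht
    exact left_mem_squareFrame ht.1 ht.2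

lemma squareIntegral_deriv_eq_zero {F f : ℂ → ℂ} {R : ℝ} (hR : 0 ≤ R)
    (hF : ∀ z ∈ squareFrame R, HasDerivAt F (f z) z)
    (hf : ∀ z ∈ squareFrame R, ContinuousAt f z) : squareIntegral f R = 0 := by
  have hb := integral_line_eq_sub (F := F) (f := f) hR (a := 0) (b := 1)
    (fun t h0 h1 => hF _ (by simpa using bottom_mem_squareFrame h0 h1))
    (fun t h0 h1 => hf _ (by simpa using bottom_mem_squareFrame h0 h1))
  have ht := integral_line_eq_sub (F := F) (f := f) hR (a := R * Complex.I) (b := 1)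
    (fun t h0 h1 => hF _ (by simpa [add_comm] using top_mem_squareFrame h0 h1))
    (fun t h0 h1 => hf _ (by simpa [add_comm] using top_mem_squareFrame h0 h1))
  have hr := integral_line_eq_sub (F := F) (f := f) hR (a := R) (b := Complex.I)
    (fun t h0 h1 => hF _ (right_mem_squareFrame h0 h1))
    (fun t h0 h1 => hf _ (right_mem_squareFrame h0 h1))
  have hl := integral_line_eq_sub (F := F) (f := f) hR (a := 0) (b := Complex.I)
    (fun t h0 h1 => hF _ (by simpa using left_mem_squareFrame h0 h1))
    (fun t h0 h1 => hf _ (by simpa using left_mem_squareFrame h0 h1))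
  simp only [zero_add, mul_one, one_mul] at hb ht hl
  simp only [add_comm ((R : ℂ) * Complex.I)] at ht
  rw [squareIntegral, hb, ht, hr, hl]
  ring

lemma log_sub_log_neg {z : ℂ} (hz : 0 < z.im) :
    Complex.log z - Complex.log (-z) = π * Complex.I := by
  simp only [Complex.log, norm_neg, Complex.arg_neg_eq_arg_sub_pi_of_im_pos hz]
  push_cast
  ring

lemma squareIntegral_inv_sub {R : ℝ} {c : ℂ} (hc : c ∈ openSquare R) :
    squareIntegral (fun z => (z - c)⁻¹) R = 2 * π * Complex.I := by
  obtain ⟨⟨h1, h2⟩, h3, h4⟩ := hc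
  have hR : 0 ≤ R := (h1.trans h2).le
  have hcont : ∀ z : ℂ, z - c ≠ 0 → ContinuousAt (fun z => (z - c)⁻¹) z := by
    intro z hz
    exact (continuousAt_id.sub continuousAt_const).inv₀ hz
  have hlog : ∀ z : ℂ, z - c ∈ Complex.slitPlane →
      HasDerivAt (fun z => Complex.log (z - c)) ((fun z => (z - c)⁻¹) z) z := by
    intro z hz
    exact (((hasDerivAt_id z).sub_const c).clog hz).congr_deriv (by simp)
  have hlog' : ∀ z : ℂ, -(z - c) ∈ Complex.slitPlane →
      HasDerivAt (fun z => Complex.log (-(z - c))) ((fun z => (z - c)⁻¹) z) z := by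
    intro z hz
    refine (((hasDerivAt_id z).sub_const c).neg.clog hz).congr_deriv ?_
    simp [← inv_neg, div_eq_mul_inv]
  have hne : ∀ z : ℂ, z ∈ Complex.slitPlane → z ≠ 0 := fun z => Complex.slitPlane_ne_zero
  have sb : ∀ t : ℝ, (0 + t * 1 : ℂ) - c ∈ Complex.slitPlane := fun t =>
    Complex.mem_slitPlane_iff.2 (Or.inr (by simp [h3.ne']))
  have st : ∀ t : ℝ, (R * Complex.I + t * 1 : ℂ) - c ∈ Complex.slitPlane := fun t =>
    Complex.mem_slitPlane_iff.2 (Or.inr (by simp [sub_ne_zero, h4.ne']))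
  have sr : ∀ t : ℝ, (R + t * Complex.I : ℂ) - c ∈ Complex.slitPlane := fun t =>
    Complex.mem_slitPlane_iff.2 (Or.inl (by simp [h2]))
  have sl : ∀ t : ℝ, -((0 + t * Complex.I : ℂ) - c) ∈ Complex.slitPlane := fun t =>
    Complex.mem_slitPlane_iff.2 (Or.inl (by simp [h1]))
  have ib := integral_line_eq_sub hR (fun t _ _ => hlog _ (sb t))
    (fun t _ _ => hcont _ (hne _ (sb t)))
  have it := integral_line_eq_sub hR (fun t _ _ => hlog _ (st t))
    (fun t _ _ => hcont _ (hne _ (st t)))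
  have ir := integral_line_eq_sub hR (fun t _ _ => hlog _ (sr t))
    (fun t _ _ => hcont _ (hne _ (sr t)))
  have il := integral_line_eq_sub hR (fun t _ _ => hlog' _ (sl t))
    (fun t _ _ => hcont _ (neg_ne_zero.1 (hne _ (sl t))))
  have l1 := log_sub_log_neg h3
  have l2 := log_sub_log_neg (z := R * Complex.I - c) (by simp [h4])
  simp only [zero_add, zero_sub, neg_neg, mul_one, one_mul, add_comm ((R : ℂ) * Complex.I)]
    at ib it ir il
  rw [squareIntegral, ib, it, ir, il]
  linear_combination l1 + l2

/-- The residue theorem for a function with simple poles in a square. -/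
theorem squareIntegral_eq_sum_residues {f r : ℂ → ℂ} {R : ℝ} (hR : 0 ≤ R) {S : Finset ℂ}
    (hS : ∀ c ∈ S, c ∈ openSquare R)
    (hf : ∀ z ∈ closedSquare R, z ∉ S → DifferentiableAt ℂ f z)
    (hr : ∀ c ∈ S, Tendsto (fun z => (z - c) * f z) (𝓝[≠] c) (𝓝 (r c))) :
    squareIntegral f R = 2 * π * Complex.I * ∑ c ∈ S, r c := by
  classical
  let p : ℂ → ℂ := fun z => ∑ c ∈ S, r c * (z - c)⁻¹
  let q : ℂ → ℂ := fun z => f z - p z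
  have hpd : ∀ z, z ∉ S → DifferentiableAt ℂ p z := by
    intro z hz
    refine DifferentiableAt.fun_sum fun c hc => ?_
    have : z - c ≠ 0 := sub_ne_zero.2 fun h => hz (h ▸ hc)
    exact (((differentiableAt_id).sub_const c).inv this).const_mul _
  have hframe : ∀ z ∈ squareFrame R, z ∉ S := fun z hz hzS => hz.2 (hS z hzS)
  have hpi : squareIntegral p R = 2 * π * Complex.I * ∑ c ∈ S, r c := by
    have key : ∀ T : Finset ℂ, T ⊆ S →
        SquareIntegrable (fun z => ∑ c ∈ T, r c * (z - c)⁻¹) R ∧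
        squareIntegral (fun z => ∑ c ∈ T, r c * (z - c)⁻¹) R =
          2 * π * Complex.I * ∑ c ∈ T, r c := by
      intro T
      induction T using Finset.induction_on with
      | empty =>
        intro _
        refine ⟨SquareIntegrable.of_continuousAt hR fun z _ => ?_, ?_⟩
        · simpa using continuousAt_const
        · simp [squareIntegral]
      | insert a T ha ih =>
        intro hT
        obtain ⟨i1, i2⟩ := ih ((Finset.subset_insert a T).trans hT)
        have haS : a ∈ S := hT (Finset.mem_insert_self a T)
        have j1 : SquareIntegrable (fun z => r a * (z - a)⁻¹) R :=
          SquareIntegrable.of_continuousAt hR fun z hz => by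
            have : z - a ≠ 0 := sub_ne_zero.2 fun h => hframe z hz (h ▸ haS)
            exact continuousAt_const.mul ((continuousAt_id.sub continuousAt_const).inv₀ this)
        simp only [Finset.sum_insert ha]
        refine ⟨j1.add i1, ?_⟩
        rw [squareIntegral_add j1 i1, i2, squareIntegral_const_mul,
          squareIntegral_inv_sub (hS a haS)]
        ring
    exact (key S subset_rfl).2
  have hqd : ∀ z ∈ closedSquare R, z ∉ S → DifferentiableAt ℂ q z := fun z hz hzS =>
    (hf z hz hzS).sub (hpd z hzS)
  have hq0 : ∀ c ∈ S, Tendsto (fun z => (z - c) * q z) (𝓝[≠] c) (𝓝 0) := by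
    intro c hc
    have hsub : ContinuousAt (fun z : ℂ => z - c) c := by fun_prop
    have hrest : Tendsto (fun z => (z - c) * ∑ d ∈ S.erase c, r d * (z - d)⁻¹) (𝓝[≠] c)
        (𝓝 0) := by
      have hcts : ContinuousAt (fun z => ∑ d ∈ S.erase c, r d * (z - d)⁻¹) c := by
        refine tendsto_finsetSum _ fun d hd => ?_
        have : c - d ≠ 0 := sub_ne_zero.2 (Finset.ne_of_mem_erase hd).symm
        exact continuousAt_const.mul ((continuousAt_id.sub continuousAt_const).inv₀ this)
      have h := (hsub.fun_mul hcts).tendsto.mono_left (nhdsWithin_le_nhds (s := {c}ᶜ))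
      simpa using h
    have hlim := ((hr c hc).sub_const (r c)).sub hrest
    rw [sub_self, sub_zero] at hlim
    refine hlim.congr' ?_
    filter_upwards [self_mem_nhdsWithin] with z hz
    have hz' : z - c ≠ 0 := sub_ne_zero.2 hz
    simp only [q, p]
    rw [← Finset.add_sum_erase S _ hc]
    field_simp
    ring
  let g : ℂ → ℂ := fun z => if z ∈ S then limUnder (𝓝[≠] z) q else q z
  have hgd : ∀ z ∈ closedSquare R, DifferentiableAt ℂ g z := by
    intro z hz
    by_cases hzS : z ∈ S
    · have hs : openSquare R \ (S.erase z : Set ℂ) ∈ 𝓝 z := by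
        refine ((isOpen_openSquare R).sdiff (S.erase z).finite_toSet.isClosed).mem_nhds
          ⟨hS z hzS, by simp⟩
      have hd : DifferentiableOn ℂ q ((openSquare R \ (S.erase z : Set ℂ)) \ {z}) := by
        rintro w ⟨⟨hw1, hw2⟩, hw3⟩
        refine (hqd w (openSquare_subset R hw1) fun hwS => hw2 ?_).differentiableWithinAt
        exact Finset.mem_coe.2 (Finset.mem_erase.2 ⟨hw3, hwS⟩)
      have ho : (fun w => q w - q z) =o[𝓝[≠] z] fun w => (w - z)⁻¹ := by
        rw [Asymptotics.isLittleO_iff_tendsto']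
        · have hsub : ContinuousAt (fun w : ℂ => (w - z) * q z) z := by fun_prop
          have h2 := hsub.tendsto.mono_left (nhdsWithin_le_nhds (s := {z}ᶜ))
          have h3 := (hq0 z hzS).sub h2
          simp only [sub_self, zero_mul] at h3
          refine h3.congr fun w => ?_
          rw [div_inv_eq_mul]
          ring
        · filter_upwards [self_mem_nhdsWithin] with w hw h0
          exact absurd (inv_eq_zero.1 h0) (sub_ne_zero.2 hw)
      have hupd := (Complex.differentiableOn_update_limUnder_of_isLittleO hs hd ho).differentiableAt
        hs
      refine hupd.congr_of_eventuallyEq ?_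
      filter_upwards [hs] with w hw
      by_cases hwz : w = z
      · subst hwz
        simp [g, hzS]
      · have hwS : w ∉ S := fun h => hw.2 (Finset.mem_coe.2 (Finset.mem_erase.2 ⟨hwz, h⟩))
        simp [g, hwS, hwz]
    · have hs : (S : Set ℂ)ᶜ ∈ 𝓝 z :=
        S.finite_toSet.isClosed.isOpen_compl.mem_nhds (by simpa using hzS)
      refine (hqd z hz hzS).congr_of_eventuallyEq ?_
      filter_upwards [hs] with w hw
      have : w ∉ S := by simpa using hw
      simp [g, this]
  have hg0 : squareIntegral g R = 0 := by
    have H : DifferentiableOn ℂ g ([[(0:ℂ).re, (R + R * Complex.I : ℂ).re]] ×ℂ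
        [[(0:ℂ).im, (R + R * Complex.I : ℂ).im]]) := by
      intro z hz
      refine (hgd z ?_).differentiableWithinAt
      rw [Complex.mem_reProdIm] at hz
      simpa [Set.uIcc_of_le hR, closedSquare] using hz
    have := Complex.integral_boundary_rect_eq_zero_of_differentiableOn g 0 (R + R * Complex.I) H
    simpa [squareIntegral] using this
  have hfg : squareIntegral f R = squareIntegral (fun z => g z + p z) R := by
    refine squareIntegral_congr hR fun z hz => ?_
    simp [g, q, hframe z hz]
  rw [hfg, squareIntegral_add, hg0, hpi, zero_add]
  · exact SquareIntegrable.of_continuousAt hR fun z hz => (hgd z hz.1).continuousAt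
  · exact SquareIntegrable.of_continuousAt hR fun z hz => (hpd z (hframe z hz)).continuousAt

/-- The entire function `sin w / w`. -/
noncomputable def sinOver : ℂ → ℂ := dslope Complex.sin 0

/-- The entire function `sinh w / w`. -/
noncomputable def sinhOver : ℂ → ℂ := dslope Complex.sinh 0

lemma differentiable_dslope {f : ℂ → ℂ} (hf : Differentiable ℂ f) :
    Differentiable ℂ (dslope f 0) := by
  rw [← differentiableOn_univ]
  exact (Complex.differentiableOn_dslope Filter.univ_mem).2 hf.differentiableOn

lemma mul_sinOver (w : ℂ) : w * sinOver w = Complex.sin w := by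
  simpa [sinOver] using sub_smul_dslope Complex.sin 0 w

lemma mul_sinhOver (w : ℂ) : w * sinhOver w = Complex.sinh w := by
  simpa [sinhOver] using sub_smul_dslope Complex.sinh 0 w

lemma sinOver_ne_zero_iff {w : ℂ} : sinOver w ≠ 0 ↔ w = 0 ∨ Complex.sin w ≠ 0 := by
  by_cases hw : w = 0
  · subst hw
    simp [sinOver]
  · simp [← mul_sinOver, hw]

lemma sinhOver_ne_zero_iff {w : ℂ} : sinhOver w ≠ 0 ↔ w = 0 ∨ Complex.sinh w ≠ 0 := by
  by_cases hw : w = 0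
  · subst hw
    simp [sinhOver]
  · simp [← mul_sinhOver, hw]

/-- The meromorphic function `(w / sin w)³`. -/
noncomputable def sinFactor (w : ℂ) : ℂ := (sinOver w)⁻¹ ^ 3

/-- The meromorphic function `w / sinh w`. -/
noncomputable def sinhFactor (w : ℂ) : ℂ := (sinhOver w)⁻¹

lemma analyticAt_sinFactor {w : ℂ} (hw : sinOver w ≠ 0) : AnalyticAt ℂ sinFactor w :=
  (((differentiable_dslope Complex.differentiable_sin).analyticAt w).inv hw).pow 3

lemma analyticAt_sinhFactor {w : ℂ} (hw : sinhOver w ≠ 0) : AnalyticAt ℂ sinhFactor w :=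
  ((differentiable_dslope Complex.differentiable_sinh).analyticAt w).inv hw

lemma sinFactor_eq {w : ℂ} (hw : Complex.sin w ≠ 0) :
    sinFactor w = w ^ 3 / Complex.sin w ^ 3 := by
  have h := mul_sinOver w
  have hw0 : w ≠ 0 := by rintro rfl; simp at hw
  have : sinOver w = Complex.sin w / w := by rw [← h]; field_simp
  rw [sinFactor, this, inv_div, div_pow]

lemma sinhFactor_eq {w : ℂ} (hw : Complex.sinh w ≠ 0) :
    sinhFactor w = w / Complex.sinh w := by
  have h := mul_sinhOver w
  have hw0 : w ≠ 0 := by rintro rfl; simp at hw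
  have : sinhOver w = Complex.sinh w / w := by rw [← h]; field_simp
  rw [sinhFactor, this, inv_div]

lemma eventually_sin_ne_zero {w : ℂ} (hw : Complex.sin w ≠ 0) :
    ∀ᶠ z in 𝓝 w, Complex.sin z ≠ 0 :=
  Complex.continuous_sin.continuousAt.eventually_ne hw

lemma eventually_sinh_ne_zero {w : ℂ} (hw : Complex.sinh w ≠ 0) :
    ∀ᶠ z in 𝓝 w, Complex.sinh z ≠ 0 :=
  Complex.continuous_sinh.continuousAt.eventually_ne hw

lemma deriv_sinhFactor {w : ℂ} (hw : Complex.sinh w ≠ 0) :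
    deriv sinhFactor w = 1 / Complex.sinh w - w * Complex.cosh w / Complex.sinh w ^ 2 := by
  have h : sinhFactor =ᶠ[𝓝 w] fun z => z / Complex.sinh z :=
    (eventually_sinh_ne_zero hw).mono fun _ => sinhFactor_eq
  rw [h.deriv_eq, ((hasDerivAt_id' w).fun_div (Complex.hasDerivAt_sinh w) hw).deriv]
  field_simp

lemma deriv_deriv_sinhFactor {w : ℂ} (hw : Complex.sinh w ≠ 0) :
    deriv (deriv sinhFactor) w = -2 * Complex.cosh w / Complex.sinh w ^ 2 - w / Complex.sinh w +
      2 * w * Complex.cosh w ^ 2 / Complex.sinh w ^ 3 := by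
  have h : deriv sinhFactor =ᶠ[𝓝 w]
      fun z => 1 / Complex.sinh z - z * Complex.cosh z / Complex.sinh z ^ 2 :=
    (eventually_sinh_ne_zero hw).mono fun _ => deriv_sinhFactor
  have hs := Complex.hasDerivAt_sinh w
  have hd := ((hasDerivAt_const w (1:ℂ)).fun_div hs hw).fun_sub
    (((hasDerivAt_id' w).fun_mul (Complex.hasDerivAt_cosh w)).fun_div (hs.fun_pow 2)
      (pow_ne_zero 2 hw))
  rw [h.deriv_eq, hd.deriv]
  field_simp
  ring

lemma deriv_sinFactor {w : ℂ} (hw : Complex.sin w ≠ 0) :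
    deriv sinFactor w =
      3 * w ^ 2 / Complex.sin w ^ 3 - 3 * w ^ 3 * Complex.cos w / Complex.sin w ^ 4 := by
  have h : sinFactor =ᶠ[𝓝 w] fun z => z ^ 3 / Complex.sin z ^ 3 :=
    (eventually_sin_ne_zero hw).mono fun _ => sinFactor_eq
  have hs := Complex.hasDerivAt_sin w
  rw [h.deriv_eq, (((hasDerivAt_id' w).fun_pow 3).fun_div (hs.fun_pow 3) (pow_ne_zero 3 hw)).deriv]
  field_simp
  ring

lemma deriv_deriv_sinFactor {w : ℂ} (hw : Complex.sin w ≠ 0) :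
    deriv (deriv sinFactor) w =
      6 * w / Complex.sin w ^ 3 - 18 * w ^ 2 * Complex.cos w / Complex.sin w ^ 4 +
        w ^ 3 * (3 / Complex.sin w ^ 3 + 12 * Complex.cos w ^ 2 / Complex.sin w ^ 5) := by
  have h : deriv sinFactor =ᶠ[𝓝 w] fun z =>
      3 * z ^ 2 / Complex.sin z ^ 3 - 3 * z ^ 3 * Complex.cos z / Complex.sin z ^ 4 :=
    (eventually_sin_ne_zero hw).mono fun _ => deriv_sinFactor
  have hs := Complex.hasDerivAt_sin w
  have hi := hasDerivAt_id' w
  have hd := (((hi.fun_pow 2).const_mul (3:ℂ)).fun_div (hs.fun_pow 3) (pow_ne_zero 3 hw)).fun_sub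
    ((((hi.fun_pow 3).const_mul (3:ℂ)).fun_mul (Complex.hasDerivAt_cos w)).fun_div (hs.fun_pow 4)
      (pow_ne_zero 4 hw))
  rw [h.deriv_eq, hd.deriv]
  field_simp
  ring

/-- The second order differential equation satisfied by `w / sinh w`. -/
lemma sinhFactor_ode {w : ℂ} (hw : sinhOver w ≠ 0) :
    w ^ 3 * deriv (deriv sinhFactor) w - 2 * w ^ 2 * deriv sinhFactor w +
      2 * w * sinhFactor w - w ^ 3 * sinhFactor w = 2 * w * sinhFactor w ^ 3 := by
  rcases sinhOver_ne_zero_iff.1 hw with rfl | hs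
  · simp
  · rw [deriv_deriv_sinhFactor hs, deriv_sinhFactor hs, sinhFactor_eq hs]
    have := Complex.cosh_sq w
    field_simp
    linear_combination 2 * w ^ 4 * this

/-- The second order differential operator adjoint to the one in `sinhFactor_ode`, applied to
`sinFactor`. -/
noncomputable def adjointSin (w : ℂ) : ℂ :=
  12 * w * sinFactor w + 8 * w ^ 2 * deriv sinFactor w + w ^ 3 * deriv (deriv sinFactor) w -
    w ^ 3 * sinFactor w

/-- The bilinear concomitant of `sinhFactor` and `sinFactor`. -/
noncomputable def concomitant (w : ℂ) : ℂ :=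
  w ^ 3 * (deriv sinhFactor w * sinFactor w - deriv sinFactor w * sinhFactor w) -
    5 * w ^ 2 * (sinFactor w * sinhFactor w)

lemma analyticAt_adjointSin {w : ℂ} (hw : sinOver w ≠ 0) : AnalyticAt ℂ adjointSin w := by
  have hg := analyticAt_sinFactor hw
  have hg1 := hg.deriv
  have hg2 := hg1.deriv
  unfold adjointSin
  fun_prop

lemma hasDerivAt_concomitant {w : ℂ} (h1 : sinOver w ≠ 0) (h2 : sinhOver w ≠ 0) :
    HasDerivAt concomitant
      (2 * (w * sinFactor w * sinhFactor w ^ 3) - sinhFactor w * adjointSin w) w := by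
  have hg := analyticAt_sinFactor h1
  have hv := analyticAt_sinhFactor h2
  have dg := hg.differentiableAt.hasDerivAt
  have dv := hv.differentiableAt.hasDerivAt
  have dg1 := hg.deriv.differentiableAt.hasDerivAt
  have dv1 := hv.deriv.differentiableAt.hasDerivAt
  have hi := hasDerivAt_id' w
  have hd := ((hi.fun_pow 3).fun_mul ((dv1.fun_mul dg).fun_sub (dg1.fun_mul dv))).fun_sub
    (((hi.fun_pow 2).const_mul (5:ℂ)).fun_mul (dg.fun_mul dv))
  refine HasDerivAt.congr_deriv (f := concomitant) hd ?_
  simp only [adjointSin]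
  norm_num
  linear_combination sinFactor w * sinhFactor_ode h2

lemma mul_adjointSin {w : ℂ} (hw : Complex.sin w ≠ 0) :
    w * adjointSin w = 42 * w ^ 5 / Complex.sin w ^ 3 -
      42 * w ^ 6 * Complex.cos w / Complex.sin w ^ 4 +
      w ^ 7 * (2 / Complex.sin w ^ 3 + 12 * Complex.cos w ^ 2 / Complex.sin w ^ 5) := by
  rw [adjointSin, deriv_deriv_sinFactor hw, deriv_sinFactor hw, sinFactor_eq hw]
  field_simp
  ring

lemma mul_adjointSin_mul_I {t : ℝ} (ht : 0 < t) :
    (t * Complex.I) * adjointSin (t * Complex.I) = -(residueTerm t : ℂ) := by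
  have hs : Complex.sinh t ≠ 0 := by
    rw [← Complex.ofReal_sinh]
    exact_mod_cast (Real.sinh_pos_iff.2 ht).ne'
  have hsin : Complex.sin (t * Complex.I) = Complex.sinh t * Complex.I := Complex.sin_mul_I _
  have hne : Complex.sin (t * Complex.I) ≠ 0 := by
    rw [hsin]
    exact mul_ne_zero hs Complex.I_ne_zero
  rw [mul_adjointSin hne, hsin, Complex.cos_mul_I]
  simp only [residueTerm, csch, coth]
  push_cast
  have hc := Complex.cosh_sq (t : ℂ)
  have hI : Complex.I ^ 2 = -1 := Complex.I_sq
  have e3 : Complex.I ^ 3 = -Complex.I := by linear_combination Complex.I * hI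
  have e4 : Complex.I ^ 4 = 1 := by linear_combination (Complex.I ^ 2 - 1) * hI
  have e5 : Complex.I ^ 5 = Complex.I := by linear_combination Complex.I * e4
  have e6 : Complex.I ^ 6 = -1 := by linear_combination Complex.I ^ 2 * e4 + hI
  have e7 : Complex.I ^ 7 = -Complex.I := by linear_combination Complex.I ^ 3 * e4 + e3
  simp only [mul_pow, e3, e4, e5, e6, e7]
  have hI0 := Complex.I_ne_zero
  field_simp
  rw [hc]
  ring

/-- The factor of the change of variables turning `cos z - cosh z` into a product. -/
noncomputable def halfOneAddI : ℂ := (1 + Complex.I) / 2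

lemma one_sub_I_mul_halfOneAddI : (1 - Complex.I) * halfOneAddI = 1 := by
  rw [halfOneAddI]
  linear_combination (-1 / 2 : ℂ) * Complex.I_sq

lemma halfOneAddI_ne_zero : halfOneAddI ≠ 0 := fun h => by
  simpa [h] using one_sub_I_mul_halfOneAddI

lemma cos_sub_cosh_eq (z : ℂ) : Complex.cos z - Complex.cosh z =
    2 * Complex.I * (Complex.sin (halfOneAddI * z) * Complex.sinh (halfOneAddI * z)) := by
  have e1 : (z + z * Complex.I) / 2 = halfOneAddI * z := by rw [halfOneAddI]; ring
  have e2 : (z - z * Complex.I) / 2 = -(halfOneAddI * z * Complex.I) := by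
    rw [halfOneAddI]
    linear_combination (z / 2) * Complex.I_sq
  rw [← Complex.cos_mul_I, Complex.cos_sub_cos, e1, e2, Complex.sin_neg, Complex.sin_mul_I]
  ring

lemma sinOver_ne_zero_of_nonneg {z : ℂ} (h1 : 0 ≤ z.re) (h2 : 0 ≤ z.im) :
    sinOver (halfOneAddI * z) ≠ 0 := by
  rw [sinOver_ne_zero_iff]
  by_contra! h
  obtain ⟨k, hk⟩ := Complex.sin_eq_zero_iff.1 h.2
  have hz : z = (1 - Complex.I) * (k * π) := by
    rw [← hk, ← mul_assoc, one_sub_I_mul_halfOneAddI, one_mul]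
  rw [hz] at h1 h2
  simp at h1 h2
  have hk0 : (k : ℝ) * π = 0 := le_antisymm (by linarith) h1
  refine h.1 ?_
  rw [hk]
  exact_mod_cast hk0

lemma sinhOver_eq_zero {z : ℂ} (h1 : 0 ≤ z.re) (h : sinhOver (halfOneAddI * z) = 0) :
    ∃ n : ℕ, 1 ≤ n ∧ z = (1 + Complex.I) * (n * π) := by
  have h' := not_or.1 (mt sinhOver_ne_zero_iff.2 (not_not.2 h))
  obtain ⟨h0, hs⟩ := h'
  rw [not_not] at hs
  have : Complex.sin (halfOneAddI * z * Complex.I) = 0 := by rw [Complex.sin_mul_I, hs, zero_mul]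
  obtain ⟨k, hk⟩ := Complex.sin_eq_zero_iff.1 this
  have hz : z = (1 + Complex.I) * ((-k : ℤ) * π) := by
    push_cast
    linear_combination (-(1 + Complex.I)) * hk + halfOneAddI * z * Complex.I_sq -
      z * one_sub_I_mul_halfOneAddI
  have hre : z.re = (-k : ℤ) * π := by
    rw [hz]
    simp
  have hk0 : (0:ℝ) ≤ (-k : ℤ) := nonneg_of_mul_nonneg_left (hre ▸ h1) pi_pos
  obtain ⟨n, hn⟩ := Int.eq_ofNat_of_zero_le (Int.cast_nonneg_iff.1 hk0)
  refine ⟨n, Nat.one_le_iff_ne_zero.2 ?_, by rw [hz, hn]; simp⟩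
  rintro rfl
  exact h0 (by rw [hz, hn]; simp)

/-- The analytic continuation of the integrand. -/
noncomputable def integrand (z : ℂ) : ℂ := z ^ 7 / (Complex.cos z - Complex.cosh z) ^ 3

lemma integrand_eq {z : ℂ} (h1 : sinOver (halfOneAddI * z) ≠ 0)
    (h2 : sinhOver (halfOneAddI * z) ≠ 0) :
    integrand z = (Complex.I - 1) * ((halfOneAddI * z) * sinFactor (halfOneAddI * z) *
      sinhFactor (halfOneAddI * z) ^ 3) := by
  rcases sinOver_ne_zero_iff.1 h1 with h0 | hs
  · have : z = 0 := (mul_eq_zero.1 h0).resolve_left halfOneAddI_ne_zero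
    simp [integrand, this]
  have hw : halfOneAddI * z ≠ 0 := by
    intro h
    simp [h] at hs
  have hsh := (sinhOver_ne_zero_iff.1 h2).resolve_left hw
  rw [integrand, cos_sub_cosh_eq, sinFactor_eq hs, sinhFactor_eq hsh]
  have hz : z = (1 - Complex.I) * (halfOneAddI * z) := by
    rw [← mul_assoc, one_sub_I_mul_halfOneAddI, one_mul]
  obtain ⟨w, hw⟩ : ∃ w, w = halfOneAddI * z := ⟨_, rfl⟩
  rw [← hw] at hz hs hsh ⊢
  rw [hz]
  have hI0 := Complex.I_ne_zero
  have hI := Complex.I_sq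
  have e : (1 - Complex.I) ^ 7 = (Complex.I - 1) * (2 * Complex.I) ^ 3 := by
    have e2 : (1 - Complex.I) ^ 2 = -2 * Complex.I := by linear_combination hI
    calc (1 - Complex.I) ^ 7 = ((1 - Complex.I) ^ 2) ^ 3 * (1 - Complex.I) := by ring
      _ = _ := by rw [e2]; ring
  rw [mul_pow, e]
  field_simp

/-- The poles of the integrand in the open first quadrant. -/
noncomputable def pole (n : ℕ) : ℂ := (1 + Complex.I) * (n * π)

lemma halfOneAddI_mul_pole (n : ℕ) : halfOneAddI * pole n = ((n * π : ℝ) : ℂ) * Complex.I := by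
  rw [halfOneAddI, pole]
  push_cast
  linear_combination (n * π / 2 : ℂ) * Complex.I_sq

lemma pole_re (n : ℕ) : (pole n).re = n * π := by simp [pole]

lemma pole_im (n : ℕ) : (pole n).im = n * π := by simp [pole]

lemma pole_injective : Function.Injective pole := by
  intro m n h
  have := congrArg Complex.re h
  rw [pole_re, pole_re] at this
  exact_mod_cast mul_right_cancel₀ pi_pos.ne' this

lemma sinh_halfOneAddI_mul_pole (n : ℕ) : Complex.sinh (halfOneAddI * pole n) = 0 := by
  rw [halfOneAddI_mul_pole, Complex.sinh_mul_I, ← Complex.ofReal_sin, sin_nat_mul_pi]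
  simp

lemma cosh_halfOneAddI_mul_pole (n : ℕ) : Complex.cosh (halfOneAddI * pole n) = (-1) ^ n := by
  rw [halfOneAddI_mul_pole, Complex.cosh_mul_I, ← Complex.ofReal_cos, cos_nat_mul_pi]
  simp

lemma tendsto_residue {n : ℕ} (hn : 1 ≤ n) :
    Tendsto (fun z => (z - pole n) *
      (sinhFactor (halfOneAddI * z) * adjointSin (halfOneAddI * z))) (𝓝[≠] pole n)
      (𝓝 ((1 - Complex.I) * ((-1) ^ (n + 1) * (residueTerm (n * π) : ℂ)))) := by
  have hk := halfOneAddI_ne_zero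
  have hnp : 0 ≤ (n:ℝ) * π := by positivity
  have hA : ContinuousAt (fun z => (halfOneAddI * z) * adjointSin (halfOneAddI * z)) (pole n) := by
    have h1 : ContinuousAt (fun z => halfOneAddI * z) (pole n) := by fun_prop
    have h2 := (analyticAt_adjointSin (sinOver_ne_zero_of_nonneg (z := pole n)
      (by rwa [pole_re]) (by rwa [pole_im]))).continuousAt
    exact h1.mul (ContinuousAt.comp (f := fun z => halfOneAddI * z) h2 h1)
  have hA' := hA.tendsto.mono_left (nhdsWithin_le_nhds (s := {pole n}ᶜ))
  rw [halfOneAddI_mul_pole, mul_adjointSin_mul_I (by positivity)] at hA'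
  have hs : HasDerivAt (fun z => Complex.sinh (halfOneAddI * z)) ((-1) ^ n * halfOneAddI)
      (pole n) := by
    have := ((hasDerivAt_id' (pole n)).const_mul halfOneAddI).csinh
    exact this.congr_deriv (by rw [cosh_halfOneAddI_mul_pole, mul_one])
  have hslope := (hasDerivAt_iff_tendsto_slope.1 hs).inv₀
    (mul_ne_zero (pow_ne_zero _ (by norm_num)) hk)
  have hprod := hslope.mul hA'
  have hval : ((-1) ^ n * halfOneAddI)⁻¹ * -(residueTerm (n * π) : ℂ) =
      (1 - Complex.I) * ((-1) ^ (n + 1) * (residueTerm (n * π) : ℂ)) := by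
    have e1 : halfOneAddI⁻¹ = 1 - Complex.I :=
      (eq_inv_of_mul_eq_one_left one_sub_I_mul_halfOneAddI).symm
    rw [mul_inv, e1, ← inv_pow, inv_neg, inv_one]
    ring
  rw [hval] at hprod
  refine hprod.congr' ?_
  have hne : ∀ᶠ z in 𝓝[≠] pole n, Complex.sinh (halfOneAddI * z) ≠ 0 := by
    have := hs.eventually_ne (c := 0) (mul_ne_zero (pow_ne_zero _ (by norm_num)) hk)
    exact this
  filter_upwards [hne, self_mem_nhdsWithin] with z hz hzn
  have : z - pole n ≠ 0 := sub_ne_zero.2 hzn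
  rw [sinhFactor_eq hz, slope_def_field, sinh_halfOneAddI_mul_pole, sub_zero]
  field_simp

/-- The half side length of the squares used, avoiding the poles. -/
noncomputable def radius (N : ℕ) : ℝ := (N + 1 / 2) * π

lemma radius_pos (N : ℕ) : 0 < radius N := by unfold radius; positivity

lemma sinhOver_ne_zero_of_notMem {N : ℕ} {z : ℂ} (hz : z ∈ closedSquare (radius N))
    (hzS : z ∉ (Finset.Icc 1 N).image pole) : sinhOver (halfOneAddI * z) ≠ 0 := by
  intro h
  obtain ⟨n, hn, hzn⟩ := sinhOver_eq_zero hz.1.1 h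
  refine hzS (Finset.mem_image.2 ⟨n, Finset.mem_Icc.2 ⟨hn, ?_⟩, hzn.symm⟩)
  have h1 := hz.1.2
  rw [hzn, ← pole, pole_re, radius] at h1
  have h2 : (n:ℝ) ≤ N + 1 / 2 := le_of_mul_le_mul_right h1 pi_pos
  have h3 : (n:ℝ) < N + 1 := by linarith
  exact Nat.lt_succ_iff.1 (by exact_mod_cast h3)

lemma pole_mem_openSquare {n N : ℕ} (h1 : 1 ≤ n) (hN : n ≤ N) :
    pole n ∈ openSquare (radius N) := by
  have h0 : 0 < (n:ℝ) * π := by positivity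
  have h2 : (n:ℝ) * π < radius N := by
    have : (n:ℝ) ≤ N := by exact_mod_cast hN
    exact mul_lt_mul_of_pos_right (by linarith) pi_pos
  simp [openSquare, pole_re, pole_im, h0, h2]

lemma squareIntegral_integrand (N : ℕ) : squareIntegral integrand (radius N) =
    2 * π * ∑ n ∈ Finset.range (N + 1), ((-1) ^ n * residueTerm (n * π) : ℂ) := by
  have hR := (radius_pos N).le
  let S := (Finset.Icc 1 N).image pole
  let G : ℂ → ℂ := fun z => sinhFactor (halfOneAddI * z) * adjointSin (halfOneAddI * z)
  let D : ℂ → ℂ := fun z => 2 * ((halfOneAddI * z) * sinFactor (halfOneAddI * z) *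
      sinhFactor (halfOneAddI * z) ^ 3) - G z
  have hS : ∀ c ∈ S, c ∈ openSquare (radius N) := by
    intro c hc
    obtain ⟨n, hn, rfl⟩ := Finset.mem_image.1 hc
    rw [Finset.mem_Icc] at hn
    exact pole_mem_openSquare hn.1 hn.2
  have h1 : ∀ z ∈ closedSquare (radius N), sinOver (halfOneAddI * z) ≠ 0 := fun z hz =>
    sinOver_ne_zero_of_nonneg hz.1.1 hz.2.1
  have h2 : ∀ z ∈ closedSquare (radius N), z ∉ S → sinhOver (halfOneAddI * z) ≠ 0 :=
    fun z hz hzS => sinhOver_ne_zero_of_notMem hz hzS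
  have hframe : ∀ z ∈ squareFrame (radius N), sinhOver (halfOneAddI * z) ≠ 0 := fun z hz =>
    h2 z hz.1 fun hzS => hz.2 (hS z hzS)
  have hline : ∀ z : ℂ, AnalyticAt ℂ (fun z => halfOneAddI * z) z := fun z => by fun_prop
  have hg : ∀ z ∈ closedSquare (radius N),
      AnalyticAt ℂ (fun z => sinFactor (halfOneAddI * z)) z := fun z hz =>
    (analyticAt_sinFactor (h1 z hz)).fun_comp (hline z)
  have hA : ∀ z ∈ closedSquare (radius N),
      AnalyticAt ℂ (fun z => adjointSin (halfOneAddI * z)) z := fun z hz =>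
    (analyticAt_adjointSin (h1 z hz)).fun_comp (hline z)
  have hv : ∀ z ∈ closedSquare (radius N), z ∉ S →
      AnalyticAt ℂ (fun z => sinhFactor (halfOneAddI * z)) z := fun z hz hzS =>
    (analyticAt_sinhFactor (h2 z hz hzS)).fun_comp (hline z)
  have hG : ∀ z ∈ closedSquare (radius N), z ∉ S → AnalyticAt ℂ G z := fun z hz hzS =>
    (hv z hz hzS).fun_mul (hA z hz)
  have hD : ∀ z ∈ closedSquare (radius N), z ∉ S → AnalyticAt ℂ D z := fun z hz hzS =>
    (analyticAt_const.fun_mul ((((hline z).fun_mul (hg z hz))).fun_mul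
      ((hv z hz hzS).fun_pow 3))).fun_sub (hG z hz hzS)
  have hfS : ∀ z ∈ squareFrame (radius N), z ∉ S := fun z hz hzS => hz.2 (hS z hzS)
  have hres := squareIntegral_eq_sum_residues (f := G)
    (r := fun c => (1 - Complex.I) * ((-1) ^ (⌊c.re / π⌋₊ + 1) * (residueTerm c.re : ℂ)))
    hR hS (fun z hz hzS => (hG z hz hzS).differentiableAt) (by
      intro c hc
      obtain ⟨n, hn, rfl⟩ := Finset.mem_image.1 hc
      rw [Finset.mem_Icc] at hn
      have hfl : ⌊(pole n).re / π⌋₊ = n := by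
        rw [pole_re, mul_div_cancel_right₀ _ pi_pos.ne', Nat.floor_natCast]
      have := tendsto_residue hn.1
      simp only [hfl]
      rwa [pole_re])
  have hDz : squareIntegral D (radius N) = 0 := by
    have := squareIntegral_deriv_eq_zero (F := fun z => concomitant (halfOneAddI * z))
      (f := fun z => halfOneAddI * D z) hR
      (fun z hz => by
        have hz1 := hasDerivAt_concomitant (h1 z hz.1) (hframe z hz)
        have hz2 := (hasDerivAt_id' z).const_mul halfOneAddI
        exact (HasDerivAt.comp z hz1 hz2).congr_deriv (by simp only [D, G]; ring))
      (fun z hz => continuousAt_const.mul (hD z hz.1 (hfS z hz)).continuousAt)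
    rw [squareIntegral_const_mul] at this
    exact (mul_eq_zero.1 this).resolve_left halfOneAddI_ne_zero
  have hsplit : squareIntegral integrand (radius N) =
      squareIntegral (fun z => (Complex.I - 1) / 2 * (D z + G z)) (radius N) := by
    refine squareIntegral_congr hR fun z hz => ?_
    rw [integrand_eq (h1 z hz.1) (hframe z hz)]
    simp only [D]
    ring
  have iD : SquareIntegrable D (radius N) :=
    SquareIntegrable.of_continuousAt hR fun z hz => (hD z hz.1 (hfS z hz)).continuousAt
  have iG : SquareIntegrable G (radius N) :=
    SquareIntegrable.of_continuousAt hR fun z hz => (hG z hz.1 (hfS z hz)).continuousAt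
  rw [hsplit, squareIntegral_const_mul, squareIntegral_add iD iG, hDz, hres,
    Finset.sum_image fun a _ b _ h => pole_injective h]
  have hsum : ∑ n ∈ Finset.Icc 1 N, (1 - Complex.I) *
      ((-1) ^ (⌊(pole n).re / π⌋₊ + 1) * (residueTerm (pole n).re : ℂ)) =
      -(1 - Complex.I) * ∑ n ∈ Finset.range (N + 1), ((-1) ^ n * residueTerm (n * π) : ℂ) := by
    have hsub : Finset.Icc 1 N ⊆ Finset.range (N + 1) := fun n hn => by
      rw [Finset.mem_Icc] at hn
      exact Finset.mem_range.2 (by omega)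
    rw [Finset.mul_sum, ← Finset.sum_subset hsub]
    · refine Finset.sum_congr rfl fun n _ => ?_
      rw [pole_re, mul_div_cancel_right₀ _ pi_pos.ne', Nat.floor_natCast]
      ring
    · intro n hn hn'
      have hn0 : n = 0 := by
        simp only [Finset.mem_range, Finset.mem_Icc] at hn hn'
        omega
      simp [hn0, residueTerm]
  rw [hsum]
  linear_combination (π * Complex.I - 2 * π) *
    (∑ n ∈ Finset.range (N + 1), ((-1) ^ n * residueTerm (n * π) : ℂ)) * Complex.I_sq

lemma cube_div_le_sinh {u : ℝ} (hu : 0 ≤ u) : u ^ 3 / 12 ≤ sinh u := by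
  have h1 := Real.sum_le_exp_of_nonneg hu 4
  have h2 : exp (-u) ≤ 1 := by simpa using hu
  simp [Finset.sum_range_succ, Nat.factorial] at h1
  rw [sinh_eq]
  nlinarith [sq_nonneg u]

lemma cosh_sub_one_eq (x : ℝ) : cosh x - 1 = 2 * sinh (x / 2) ^ 2 := by
  have h := cosh_two_mul (x / 2)
  rw [mul_div_cancel₀ x two_ne_zero, cosh_sq] at h
  rw [h]
  ring

lemma sinh_le_norm_sin_mul_norm_sinh {a b c : ℝ} (hc : 0 ≤ c) (hb : c ≤ b)
    (hab : sin b ^ 2 = cos a ^ 2) :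
    sinh c ≤ ‖Complex.sin (a + b * Complex.I)‖ * ‖Complex.sinh (a + b * Complex.I)‖ := by
  have hcb : sinh c ^ 2 ≤ sinh b ^ 2 :=
    pow_le_pow_left₀ (sinh_nonneg_iff.2 hc) (sinh_le_sinh.2 hb) 2
  have hsa : sin a ^ 2 ≤ sinh a ^ 2 := by
    rw [← sq_abs (sinh a), abs_sinh, ← sq_abs (sin a)]
    exact pow_le_pow_left₀ (abs_nonneg _)
      (abs_sin_le_abs.trans (self_le_sinh_iff.2 (abs_nonneg a))) 2
  have h1 : sinh c ≤ ‖Complex.sin (a + b * Complex.I)‖ := by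
    refine le_of_sq_le_sq ?_ (norm_nonneg _)
    have e : Complex.sin (a + b * Complex.I) =
        ((sin a * cosh b : ℝ) : ℂ) + ((cos a * sinh b : ℝ) : ℂ) * Complex.I := by
      rw [Complex.sin_add_mul_I]
      push_cast
      rfl
    rw [Complex.sq_norm, e, Complex.normSq_add_mul_I, mul_pow, mul_pow, cosh_sq b]
    nlinarith [sin_sq_add_cos_sq a, sq_nonneg (sin a)]
  have h2 : 1 ≤ ‖Complex.sinh (a + b * Complex.I)‖ := by
    refine le_of_sq_le_sq ?_ (norm_nonneg _)
    have e : Complex.sinh (a + b * Complex.I) =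
        ((sinh a * cos b : ℝ) : ℂ) + ((cosh a * sin b : ℝ) : ℂ) * Complex.I := by
      rw [Complex.sinh_add, Complex.sinh_mul_I, Complex.cosh_mul_I]
      push_cast
      ring
    rw [Complex.sq_norm, e, Complex.normSq_add_mul_I, mul_pow, mul_pow, cosh_sq a, cos_sq' b, hab]
    nlinarith [sin_sq_add_cos_sq a]
  nlinarith [norm_nonneg (Complex.sin (a + b * Complex.I))]

/-- The integrand on the positive real axis. -/
noncomputable def realIntegrand (x : ℝ) : ℝ := x ^ 7 / (cos x - cosh x) ^ 3

lemma integrand_ofReal (x : ℝ) : integrand x = (realIntegrand x : ℂ) := by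
  simp [integrand, realIntegrand]

lemma integrand_mul_I (z : ℂ) : integrand (z * Complex.I) = Complex.I * integrand z := by
  rw [integrand, integrand, Complex.cos_mul_I, Complex.cosh_mul_I, mul_pow,
    ← neg_sub (Complex.cos z), Odd.neg_pow (by decide)]
  have : Complex.I ^ 7 = -Complex.I := by
    linear_combination (Complex.I ^ 5 - Complex.I ^ 3 + Complex.I) * Complex.I_sq
  rw [this, mul_neg, neg_div_neg_eq]
  ring

lemma integrableOn_realIntegrand : MeasureTheory.IntegrableOn realIntegrand (Set.Ioi 0) := by
  have hneg : ∀ x : ℝ, 0 < x → cos x - cosh x < 0 := by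
    intro x hx
    have := one_lt_cosh.2 hx.ne'
    linarith [cos_le_one x]
  have hcont : ContinuousOn realIntegrand (Set.Ioi 0) := by
    intro x hx
    have h := (hneg x hx).ne
    refine ContinuousAt.continuousWithinAt ?_
    exact (continuousAt_id.pow 7).div
      ((continuous_cos.continuousAt.sub continuous_cosh.continuousAt).pow 3) (pow_ne_zero 3 h)
  refine ((integrable_inv_one_add_sq.const_mul (2 * 4608 ^ 3)).integrableOn).mono'
    (hcont.aestronglyMeasurable measurableSet_Ioi) ?_
  refine (MeasureTheory.ae_restrict_iff' measurableSet_Ioi).2 (Eventually.of_forall fun x hx => ?_)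
  have hx0 : 0 < x := hx
  obtain ⟨d, hd⟩ : ∃ d, d = cosh x - cos x := ⟨_, rfl⟩
  have hs1 : x / 2 ≤ sinh (x / 2) := self_le_sinh_iff.2 (by positivity)
  have hs2 := cube_div_le_sinh (u := x / 2) (by positivity)
  have hc := cosh_sub_one_eq x
  have hd1 : x ^ 2 / 2 ≤ d := by
    have : (x / 2) ^ 2 ≤ sinh (x / 2) ^ 2 := by gcongr
    linarith [cos_le_one x]
  have hd2 : x ^ 6 / 4608 ≤ d := by
    have : ((x / 2) ^ 3 / 12) ^ 2 ≤ sinh (x / 2) ^ 2 := by gcongr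
    nlinarith [cos_le_one x]
  have hd0 : 0 < d := lt_of_lt_of_le (by positivity) hd1
  have hD1 : (x ^ 2 / 2) ^ 3 ≤ d ^ 3 := by gcongr
  have hD2 : (x ^ 6 / 4608) ^ 3 ≤ d ^ 3 := by gcongr
  have hnorm : ‖realIntegrand x‖ = x ^ 7 / d ^ 3 := by
    rw [realIntegrand, norm_div, norm_pow, norm_pow, Real.norm_of_nonneg hx0.le, Real.norm_eq_abs,
      abs_sub_comm, ← hd, abs_of_pos hd0]
  rw [hnorm, ← div_eq_mul_inv, div_le_div_iff₀ (by positivity) (by positivity)]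
  rcases le_total x 1 with h1 | h1
  · have e1 : x ^ 7 ≤ x ^ 6 := pow_le_pow_of_le_one hx0.le h1 (by norm_num)
    have e2 : x ^ 9 ≤ x ^ 6 := pow_le_pow_of_le_one hx0.le h1 (by norm_num)
    have e3 : 0 < d ^ 3 := by positivity
    nlinarith
  · have e1 : x ^ 7 ≤ x ^ 18 := pow_le_pow_right₀ h1 (by norm_num)
    have e2 : x ^ 9 ≤ x ^ 18 := pow_le_pow_right₀ h1 (by norm_num)
    nlinarith

lemma norm_integrand_le {R a b : ℝ} {z : ℂ} (hR : 0 < R) (hz : ‖z‖ ≤ 2 * R)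
    (hw : halfOneAddI * z = a + b * Complex.I) (hb : R / 2 ≤ b) (hab : sin b ^ 2 = cos a ^ 2) :
    ‖integrand z‖ ≤ (2 * R) ^ 7 / (2 * sinh (R / 2)) ^ 3 := by
  have h1 := sinh_le_norm_sin_mul_norm_sinh (by positivity) hb hab
  have h2 : 0 < sinh (R / 2) := sinh_pos_iff.2 (by positivity)
  rw [integrand, cos_sub_cosh_eq, hw, norm_div, norm_pow, norm_pow, norm_mul, norm_mul, norm_mul,
    Complex.norm_I, mul_one, Complex.norm_ofNat]
  gcongr

lemma sin_radius_sub_sq (N : ℕ) (a : ℝ) : sin (radius N - a) ^ 2 = cos a ^ 2 := by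
  have : radius N - a = N * π - (a - π / 2) := by rw [radius]; ring
  rw [this, sin_nat_mul_pi_sub, sin_sub_pi_div_two]
  have h : ((-1 : ℝ) ^ N) ^ 2 = 1 := by rw [← pow_mul, mul_comm, pow_mul]; norm_num
  linear_combination cos a ^ 2 * h

lemma norm_integrand_right_le (N : ℕ) {t : ℝ} (h0 : 0 ≤ t) (ht : t ≤ radius N) :
    ‖integrand (radius N + t * Complex.I)‖ ≤
      (2 * radius N) ^ 7 / (2 * sinh (radius N / 2)) ^ 3 := by
  have hR := radius_pos N
  refine norm_integrand_le (a := (radius N - t) / 2) (b := radius N - (radius N - t) / 2) hR ?_ ?_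
    (by linarith) (sin_radius_sub_sq N _)
  · refine (norm_add_le _ _).trans ?_
    rw [norm_mul, Complex.norm_I, Complex.norm_real, Complex.norm_real,
      Real.norm_of_nonneg hR.le, Real.norm_of_nonneg h0]
    linarith
  · rw [halfOneAddI]
    push_cast
    linear_combination (t / 2 : ℂ) * Complex.I_sq

lemma norm_integrand_top_le (N : ℕ) {t : ℝ} (h0 : 0 ≤ t) (ht : t ≤ radius N) :
    ‖integrand (t + radius N * Complex.I)‖ ≤
      (2 * radius N) ^ 7 / (2 * sinh (radius N / 2)) ^ 3 := by
  have hR := radius_pos N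
  refine norm_integrand_le (a := (t - radius N) / 2) (b := radius N - (radius N - t) / 2) hR ?_ ?_
    (by linarith) ?_
  · refine (norm_add_le _ _).trans ?_
    rw [norm_mul, Complex.norm_I, Complex.norm_real, Complex.norm_real,
      Real.norm_of_nonneg hR.le, Real.norm_of_nonneg h0]
    linarith
  · rw [halfOneAddI]
    push_cast
    linear_combination (radius N / 2 : ℂ) * Complex.I_sq
  · rw [sin_radius_sub_sq, ← cos_neg]
    ring_nf

lemma tendsto_radius : Tendsto radius atTop atTop :=
  (tendsto_atTop_add_const_right _ _ tendsto_natCast_atTop_atTop).atTop_mul_const pi_pos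

lemma tendsto_side_bound : Tendsto (fun N : ℕ =>
    (2 * radius N) ^ 7 / (2 * sinh (radius N / 2)) ^ 3 * radius N) atTop (𝓝 0) := by
  have hlim : Tendsto (fun N : ℕ => 2 ^ 13 * 12 ^ 3 * (radius N)⁻¹) atTop (𝓝 0) := by
    simpa using (tendsto_radius.inv_tendsto_atTop).const_mul (2 ^ 13 * 12 ^ 3 : ℝ)
  refine squeeze_zero (fun N => ?_) (fun N => ?_) hlim
  · have hR := radius_pos N
    have h2 : 0 < sinh (radius N / 2) := sinh_pos_iff.2 (by positivity)
    positivity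
  · have hR := radius_pos N
    obtain ⟨R, hRe⟩ : ∃ R, R = radius N := ⟨_, rfl⟩
    rw [← hRe] at hR ⊢
    have h1 := cube_div_le_sinh (u := R / 2) (by positivity)
    calc (2 * R) ^ 7 / (2 * sinh (R / 2)) ^ 3 * R
        ≤ (2 * R) ^ 7 / (2 * ((R / 2) ^ 3 / 12)) ^ 3 * R := by gcongr
      _ = 2 ^ 13 * 12 ^ 3 * R⁻¹ := by field_simp

lemma squareIntegral_integrand_sub_norm_le (N : ℕ) :
    ‖squareIntegral integrand (radius N) -
      2 * ((∫ x in (0:ℝ)..radius N, realIntegrand x : ℝ) : ℂ)‖ ≤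
    2 * ((2 * radius N) ^ 7 / (2 * sinh (radius N / 2)) ^ 3 * radius N) := by
  have hR := (radius_pos N).le
  have ht : ‖∫ t in (0:ℝ)..radius N, integrand (t + radius N * Complex.I)‖ ≤
      (2 * radius N) ^ 7 / (2 * sinh (radius N / 2)) ^ 3 * |radius N - 0| :=
    intervalIntegral.norm_integral_le_of_norm_le_const fun t ht => by
      rw [Set.uIoc_of_le hR] at ht
      exact norm_integrand_top_le N ht.1.le ht.2
  have hr : ‖∫ t in (0:ℝ)..radius N, integrand (radius N + t * Complex.I)‖ ≤
      (2 * radius N) ^ 7 / (2 * sinh (radius N / 2)) ^ 3 * |radius N - 0| :=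
    intervalIntegral.norm_integral_le_of_norm_le_const fun t ht => by
      rw [Set.uIoc_of_le hR] at ht
      exact norm_integrand_right_le N ht.1.le ht.2
  rw [sub_zero, abs_of_nonneg hR] at ht hr
  have e : squareIntegral integrand (radius N) -
      2 * ((∫ x in (0:ℝ)..radius N, realIntegrand x : ℝ) : ℂ) =
      Complex.I * (∫ t in (0:ℝ)..radius N, integrand (radius N + t * Complex.I)) -
        ∫ t in (0:ℝ)..radius N, integrand (t + radius N * Complex.I) := by
    simp only [squareIntegral, integrand_mul_I, integrand_ofReal,
      intervalIntegral.integral_const_mul, intervalIntegral.integral_ofReal]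
    linear_combination (-((∫ x in (0:ℝ)..radius N, realIntegrand x : ℝ) : ℂ)) * Complex.I_sq
  rw [e]
  refine (norm_sub_le _ _).trans ?_
  rw [norm_mul, Complex.norm_I, one_mul]
  linarith

/-- The integral as the limit of the residue sums. -/
theorem integral_realIntegrand {V : ℝ}
    (hV : HasSum (fun n : ℕ => (-1 : ℝ) ^ n * residueTerm (n * π)) V) :
    ∫ x in Set.Ioi (0:ℝ), realIntegrand x = π * V := by
  have h1 := MeasureTheory.intervalIntegral_tendsto_integral_Ioi 0 integrableOn_realIntegrand
    tendsto_radius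
  have h2 := (hV.tendsto_sum_nat.comp (tendsto_add_atTop_nat 1)).const_mul (2 * π)
  have h3 : Tendsto (fun N : ℕ => 2 * π *
      (∑ n ∈ Finset.range (N + 1), (-1 : ℝ) ^ n * residueTerm (n * π)) -
        2 * ∫ x in (0:ℝ)..radius N, realIntegrand x) atTop (𝓝 0) := by
    have hb := tendsto_side_bound.const_mul 2
    rw [mul_zero] at hb
    refine squeeze_zero_norm (fun N => ?_) hb
    have := squareIntegral_integrand_sub_norm_le N
    rw [squareIntegral_integrand] at this
    refine le_of_eq_of_le ?_ this
    rw [← Complex.norm_real]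
    push_cast
    rfl
  have h4 := tendsto_nhds_unique h3 (h2.sub (h1.const_mul 2))
  linarith

end HyperbolicSum

theorem integral_x7_cos_minus_cosh_cubed :
    (∫ x in Set.Ioi (0:ℝ), x ^ 7 / (Real.cos x - Real.cosh x) ^ 3) =
      -(105 * Real.Gamma (1/4) ^ 8 / (2 ^ 11 * π ^ 2))
    - 21 * Real.Gamma (1/4) ^ 16 / (2 ^ 16 * π ^ 6)
    + 7 * Real.Gamma (1/4) ^ 16 / (2 ^ 14 * π ^ 5)
    - 9 * Real.Gamma (1/4) ^ 16 / (2 ^ 17 * π ^ 4)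
    - 5 * Real.Gamma (1/4) ^ 24 / (2 ^ 23 * π ^ 10) :=
  (HyperbolicSum.integral_realIntegrand HyperbolicSum.hasSum_residueTerm).trans
    HyperbolicSum.residueTerm_sum_eq
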